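/- arXiv:1910.00126 — 2 statements merged into one kernel-verified Lean document; each statement's English description precedes it below -/
import Mathlib

section
/- Let Λ₀ ⊂ ℝᵈ be a unimodular lattice which maximizes the length of its shortest nonzero vector (with respect to the Euclidean norm) among all unimodular lattices. If g ∈ SL_d(ℝ) is sufficiently close to the identity and gΛ₀ also maximizes the shortest-vector length, then g ∈ SO(d). Consequently, the set of such critical lattices is a finite union of SO(d)-orbits in SL_d(ℝ)/SL_d(ℤ). -/
open Matrix

variable {d : ℕ}

/-- the points of the lattice spanned by the columns of `g` -/
def latticePts (g : Matrix (Fin d) (Fin d) ℝ) : Set (Fin d → ℝ) :=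
  {v | ∃ m : Fin d → ℤ, v = g.mulVec fun i => (m i : ℝ)}

/-- the Euclidean norm on `Fin d → ℝ` -/
noncomputable def eNorm (v : Fin d → ℝ) : ℝ := Real.sqrt (∑ i, (v i) ^ 2)

/-- the minimal Euclidean norm of a nonzero vector of the lattice spanned by `g` -/
noncomputable def shortestLen (g : Matrix (Fin d) (Fin d) ℝ) : ℝ :=
  sInf {x : ℝ | ∃ m : Fin d → ℤ, m ≠ 0 ∧ x = eNorm (g.mulVec fun i => (m i : ℝ))}

/-- a unimodular lattice is critical if it maximizes the shortest-vector length among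
all unimodular lattices -/
def IsCriticalLattice (g : Matrix (Fin d) (Fin d) ℝ) : Prop :=
  g.det = 1 ∧ ∀ g' : Matrix (Fin d) (Fin d) ℝ, g'.det = 1 → shortestLen g' ≤ shortestLen g

/-- an integer vector viewed as a real vector -/
abbrev intVec (m : Fin d → ℤ) : Fin d → ℝ := fun i => (m i : ℝ)

/-- the coordinates of the minimal vectors of the lattice spanned by `g` -/
def minVecs (g : Matrix (Fin d) (Fin d) ℝ) : Set (Fin d → ℤ) :=
  {m | m ≠ 0 ∧ eNorm (g *ᵥ intVec m) = shortestLen g}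

lemma eNorm_eq_norm (v : Fin d → ℝ) : eNorm v = ‖WithLp.toLp 2 v‖ := by
  simp [eNorm, EuclideanSpace.norm_eq]

lemma eNorm_nonneg (v : Fin d → ℝ) : 0 ≤ eNorm v := Real.sqrt_nonneg _

lemma eNorm_sq (v : Fin d → ℝ) : eNorm v ^ 2 = v ⬝ᵥ v := by
  rw [eNorm, Real.sq_sqrt (Finset.sum_nonneg fun i _ => sq_nonneg _)]
  simp [dotProduct, sq]

lemma eNorm_smul (c : ℝ) (v : Fin d → ℝ) : eNorm (c • v) = |c| * eNorm v := by
  simp [eNorm_eq_norm, norm_smul]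

lemma abs_apply_le_eNorm (v : Fin d → ℝ) (i : Fin d) : |v i| ≤ eNorm v := by
  rw [eNorm_eq_norm]
  exact PiLp.norm_apply_le (WithLp.toLp 2 v) i

lemma continuous_eNorm : Continuous (eNorm : (Fin d → ℝ) → ℝ) := by
  unfold eNorm
  fun_prop

open scoped Matrix.Norms.L2Operator in
lemma eNorm_le_two_mul_of_norm_lt {C : Matrix (Fin d) (Fin d) ℝ} (hC : ‖1 - C‖ < 1 / 2)
    (v : Fin d → ℝ) : eNorm v ≤ 2 * eNorm (C *ᵥ v) := by
  have hle : ‖WithLp.toLp 2 ((1 - C) *ᵥ v)‖ ≤ ‖1 - C‖ * ‖WithLp.toLp 2 v‖ :=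
    l2_opNorm_mulVec (1 - C) (WithLp.toLp 2 v)
  have hsplit : WithLp.toLp 2 v = WithLp.toLp 2 (C *ᵥ v) + WithLp.toLp 2 ((1 - C) *ᵥ v) := by
    rw [← WithLp.toLp_add, ← add_mulVec, add_sub_cancel, one_mulVec]
  have htri := norm_add_le (WithLp.toLp 2 (C *ᵥ v)) (WithLp.toLp 2 ((1 - C) *ᵥ v))
  rw [← hsplit] at htri
  rw [eNorm_eq_norm, eNorm_eq_norm]
  have hmul := mul_le_mul_of_nonneg_right hC.le (norm_nonneg (WithLp.toLp 2 v))
  linarith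

open scoped Matrix.Norms.L2Operator in
lemma eventually_eNorm_le_two_mul :
    ∀ᶠ C in nhds (1 : Matrix (Fin d) (Fin d) ℝ), ∀ v, eNorm v ≤ 2 * eNorm (C *ᵥ v) := by
  have hcont : Continuous fun C : Matrix (Fin d) (Fin d) ℝ => ‖1 - C‖ := by fun_prop
  have hlt := (hcont.tendsto 1).eventually_lt_const (u := 1 / 2) (by simp)
  exact hlt.mono fun C hC => eNorm_le_two_mul_of_norm_lt hC

lemma shortestLen_le (g : Matrix (Fin d) (Fin d) ℝ) {m : Fin d → ℤ} (hm : m ≠ 0) :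
    shortestLen g ≤ eNorm (g *ᵥ intVec m) :=
  csInf_le ⟨0, by rintro x ⟨m, -, rfl⟩; exact eNorm_nonneg _⟩ ⟨m, hm, rfl⟩

lemma le_shortestLen [NeZero d] {g : Matrix (Fin d) (Fin d) ℝ} {c : ℝ}
    (h : ∀ m : Fin d → ℤ, m ≠ 0 → c ≤ eNorm (g *ᵥ intVec m)) : c ≤ shortestLen g := by
  refine le_csInf ⟨_, fun _ => 1, ?_, rfl⟩ ?_
  · intro h0
    simpa using congrFun h0 0
  · rintro x ⟨m, hm, rfl⟩
    exact h m hm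

lemma one_le_shortestLen_one [NeZero d] : 1 ≤ shortestLen (1 : Matrix (Fin d) (Fin d) ℝ) := by
  refine le_shortestLen fun m hm => ?_
  obtain ⟨i, hi⟩ := Function.ne_iff.mp hm
  have h : (1 : ℝ) ≤ |(m i : ℝ)| := by exact_mod_cast Int.one_le_abs hi
  rw [one_mulVec]
  exact h.trans (abs_apply_le_eNorm (intVec m) i)

lemma IsCriticalLattice.shortestLen_pos [NeZero d] {g : Matrix (Fin d) (Fin d) ℝ}
    (hg : IsCriticalLattice g) : 0 < shortestLen g :=
  zero_lt_one.trans_le (one_le_shortestLen_one.trans (hg.2 1 det_one))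

lemma IsCriticalLattice.shortestLen_eq {g h : Matrix (Fin d) (Fin d) ℝ}
    (hg : IsCriticalLattice g) (hh : IsCriticalLattice h) : shortestLen g = shortestLen h :=
  le_antisymm (hh.2 g hg.1) (hg.2 h hh.1)

lemma finite_eNorm_mulVec_le {g : Matrix (Fin d) (Fin d) ℝ} (hg : g.det = 1) (R : ℝ) :
    {m : Fin d → ℤ | eNorm (g *ᵥ intVec m) ≤ R}.Finite := by
  obtain ⟨B, hB⟩ := (isCompact_Icc (a := fun _ : Fin d => -R) (b := fun _ => R)
    ).exists_bound_of_continuousOn (f := fun v => g.adjugate *ᵥ v)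
    (Continuous.continuousOn (by fun_prop))
  refine (Set.finite_Icc (fun _ : Fin d => -⌈B⌉) (fun _ => ⌈B⌉)).subset fun m hm => ?_
  have hv : g *ᵥ intVec m ∈ Set.Icc (fun _ : Fin d => -R) (fun _ => R) := by
    have h i := abs_le.mp ((abs_apply_le_eNorm _ i).trans hm)
    exact ⟨fun i => (h i).1, fun i => (h i).2⟩
  have hb := hB _ hv
  simp only [mulVec_mulVec, adjugate_mul, hg, one_smul, one_mulVec] at hb
  have h i : |m i| ≤ ⌈B⌉ := by
    have : ((|m i| : ℤ) : ℝ) ≤ B := by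
      push_cast
      exact (norm_le_pi_norm (intVec m) i).trans hb
    exact_mod_cast this.trans (Int.le_ceil B)
  exact ⟨fun i => (abs_le.mp (h i)).1, fun i => (abs_le.mp (h i)).2⟩

/-- Near the identity, a deformation cannot turn a non-minimal vector into a minimal one. -/
lemma shortestLen_lt_of_near_one [NeZero d] {g : Matrix (Fin d) (Fin d) ℝ}
    (hg : IsCriticalLattice g) :
    ∀ᶠ C in nhds (1 : Matrix (Fin d) (Fin d) ℝ), ∀ m : Fin d → ℤ, m ≠ 0 → m ∉ minVecs g →
      shortestLen g < eNorm (C *ᵥ (g *ᵥ intVec m)) := by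
  have hfin := finite_eNorm_mulVec_le hg.1 (2 * shortestLen g)
  have hev : ∀ᶠ C in nhds (1 : Matrix (Fin d) (Fin d) ℝ),
      ∀ m ∈ {m : Fin d → ℤ | eNorm (g *ᵥ intVec m) ≤ 2 * shortestLen g},
        m ≠ 0 → m ∉ minVecs g → shortestLen g < eNorm (C *ᵥ (g *ᵥ intVec m)) := by
    refine (Filter.eventually_all_finite hfin).mpr fun m _ => ?_
    by_cases hm : m ≠ 0 ∧ m ∉ minVecs g
    · have hlt : shortestLen g < eNorm (g *ᵥ intVec m) :=
        (shortestLen_le g hm.1).lt_of_ne fun h => hm.2 ⟨hm.1, h.symm⟩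
      have hc : Continuous fun C : Matrix (Fin d) (Fin d) ℝ => eNorm (C *ᵥ (g *ᵥ intVec m)) :=
        continuous_eNorm.comp (by fun_prop)
      have ht := hc.tendsto 1
      rw [one_mulVec] at ht
      exact (ht.eventually_const_lt hlt).mono fun C hC _ _ => hC
    · exact Filter.Eventually.of_forall fun C h0 h1 => absurd ⟨h0, h1⟩ hm
  filter_upwards [hev, eventually_eNorm_le_two_mul] with C hC hC2 m hm hmin
  by_cases hle : eNorm (g *ᵥ intVec m) ≤ 2 * shortestLen g
  · exact hC m hle hm hmin
  · linarith [hC2 (g *ᵥ intVec m)]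

/-- A critical lattice admits no lattice deformation of shrinking determinant that does not
shorten its nonzero vectors. -/
lemma IsCriticalLattice.one_le_det [NeZero d] {g C : Matrix (Fin d) (Fin d) ℝ}
    (hg : IsCriticalLattice g) (hpos : 0 < C.det)
    (hC : ∀ m : Fin d → ℤ, m ≠ 0 → shortestLen g ≤ eNorm (C *ᵥ (g *ᵥ intVec m))) :
    1 ≤ C.det := by
  by_contra! hlt
  set c : ℝ := (C.det⁻¹) ^ ((d : ℝ)⁻¹) with hc
  have hd : (0 : ℝ) < (d : ℝ)⁻¹ := inv_pos.mpr (Nat.cast_pos.mpr (NeZero.pos d))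
  have hc1 : 1 < c := Real.one_lt_rpow ((one_lt_inv₀ hpos).mpr hlt) hd
  have hcd : c ^ d = C.det⁻¹ := Real.rpow_inv_natCast_pow (inv_pos.mpr hpos).le (NeZero.ne d)
  have hdet : (c • (C * g)).det = 1 := by
    rw [det_smul, det_mul, hg.1, Fintype.card_fin, hcd, mul_one, inv_mul_cancel₀ hpos.ne']
  have hlen : c * shortestLen g ≤ shortestLen (c • (C * g)) := by
    refine le_shortestLen fun m hm => ?_
    rw [smul_mulVec, eNorm_smul, abs_of_pos (zero_lt_one.trans hc1), ← mulVec_mulVec]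
    exact mul_le_mul_of_nonneg_left (hC m hm) (zero_lt_one.trans hc1).le
  nlinarith [hg.2 _ hdet, hg.shortestLen_pos]

lemma eventually_det_one_sub_smul {K : Matrix (Fin d) (Fin d) ℝ} (hK : 0 < K.trace) :
    ∀ᶠ s in nhdsWithin (0 : ℝ) (Set.Ioi 0), (1 - s • K).det < 1 := by
  set p : Polynomial ℝ := (1 + (Polynomial.X : Polynomial ℝ) • (-K).map Polynomial.C).det with hp
  have heval (s : ℝ) : p.eval s = (1 - s • K).det := by
    rw [hp, ← Polynomial.coe_evalRingHom, RingHom.map_det]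
    congr 1
    ext i j
    by_cases hij : i = j <;> simp [hij, sub_eq_add_neg, mul_comm s]
  have hder : HasDerivAt (fun s : ℝ => (1 - s • K).det) (-K.trace) 0 := by
    have h := p.hasDerivAt 0
    rw [hp, Matrix.derivative_det_one_add_X_smul, Matrix.trace_neg, ← hp] at h
    simpa only [heval] using h
  have hslope := (hasDerivAt_iff_tendsto_slope.mp hder).mono_left
    (nhdsWithin_mono 0 fun s (hs : 0 < s) => hs.ne')
  filter_upwards [hslope.eventually_lt_const (neg_neg_of_pos hK), self_mem_nhdsWithin]
    with s hs (hs0 : 0 < s)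
  simp only [slope_def_field, zero_smul, sub_zero, det_one] at hs
  rw [div_lt_iff₀ hs0, zero_mul] at hs
  linarith

/-- The first-order optimality condition satisfied by critical lattices. -/
lemma IsCriticalLattice.trace_nonpos [NeZero d] {g : Matrix (Fin d) (Fin d) ℝ}
    (hg : IsCriticalLattice g) {K : Matrix (Fin d) (Fin d) ℝ}
    (hK : ∀ m ∈ minVecs g, (g *ᵥ intVec m) ⬝ᵥ (K *ᵥ (g *ᵥ intVec m)) ≤ 0) : K.trace ≤ 0 := by
  by_contra! htr
  have hcont : Continuous fun s : ℝ => 1 - s • K := by fun_prop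
  have htend : Filter.Tendsto (fun s : ℝ => 1 - s • K) (nhdsWithin 0 (Set.Ioi 0))
      (nhds 1) := by
    have h := hcont.tendsto 0
    simp only [zero_smul, sub_zero] at h
    exact h.mono_left nhdsWithin_le_nhds
  have hdetpos : ∀ᶠ C in nhds (1 : Matrix (Fin d) (Fin d) ℝ), 0 < C.det :=
    (continuous_id.matrix_det).continuousAt.eventually_const_lt (by simp)
  obtain ⟨s, hlt, hpos, hfar, hs0⟩ := ((eventually_det_one_sub_smul htr).and
    ((htend.eventually hdetpos).and ((htend.eventually (shortestLen_lt_of_near_one hg)).and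
      self_mem_nhdsWithin))).exists
  refine hlt.not_ge (hg.one_le_det hpos fun m hm => ?_)
  by_cases hmin : m ∈ minVecs g
  · rw [← hmin.2]
    refine le_of_sq_le_sq ?_ (eNorm_nonneg _)
    rw [eNorm_sq, eNorm_sq]
    have hq := hK m hmin
    set v := g *ᵥ intVec m
    have hsq : 0 ≤ (K *ᵥ v) ⬝ᵥ (K *ᵥ v) := by
      rw [← eNorm_sq]
      positivity
    have hexp : ((1 - s • K) *ᵥ v) ⬝ᵥ ((1 - s • K) *ᵥ v) =
        v ⬝ᵥ v - 2 * s * (v ⬝ᵥ (K *ᵥ v)) + s ^ 2 * ((K *ᵥ v) ⬝ᵥ (K *ᵥ v)) := by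
      simp only [sub_mulVec, one_mulVec, smul_mulVec, sub_dotProduct, dotProduct_sub,
        smul_dotProduct, dotProduct_smul, smul_eq_mul, dotProduct_comm (K *ᵥ v) v]
      ring
    have hs : 0 < s := hs0
    rw [hexp]
    nlinarith [mul_nonneg (sq_nonneg s) hsq]
  · exact (hfar m hm hmin).le

lemma eq_one_of_posDef_of_det_eq_one_of_trace_le {P : Matrix (Fin d) (Fin d) ℝ} (hP : P.PosDef)
    (hdet : P.det = 1) (htr : P.trace ≤ d) : P = 1 := by
  have hH := hP.isHermitian
  have hpos := hP.eigenvalues_pos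
  have hprod : ∏ i, hH.eigenvalues i = 1 := by
    simpa [hdet] using hH.det_eq_prod_eigenvalues.symm
  have hsum : ∑ i, hH.eigenvalues i ≤ d := by
    simpa [hH.trace_eq_sum_eigenvalues] using htr
  have hlog : ∑ i, Real.log (hH.eigenvalues i) = 0 := by
    rw [← Real.log_prod fun i _ => (hpos i).ne', hprod, Real.log_one]
  have hnonneg i : 0 ≤ hH.eigenvalues i - 1 - Real.log (hH.eigenvalues i) := by
    linarith [Real.log_le_sub_one_of_pos (hpos i)]
  have hzero : ∑ i, (hH.eigenvalues i - 1 - Real.log (hH.eigenvalues i)) = 0 := by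
    refine le_antisymm ?_ (Finset.sum_nonneg fun i _ => hnonneg i)
    simp only [Finset.sum_sub_distrib, hlog]
    simpa using hsum
  have hone : hH.eigenvalues = fun _ => 1 := by
    funext i
    have hi := (Finset.sum_eq_zero_iff_of_nonneg fun i _ => hnonneg i).mp hzero i
      (Finset.mem_univ i)
    by_contra hne
    linarith [Real.log_lt_sub_one_of_pos (hpos i) hne]
  have hspec := hH.spectral_theorem
  rw [hone] at hspec
  have hd : (diagonal (RCLike.ofReal ∘ fun _ : Fin d => (1 : ℝ)) :
      Matrix (Fin d) (Fin d) ℝ) = 1 := by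
    ext i j
    simp [diagonal, one_apply]
  rw [hspec, hd, map_one]

/-- A critical lattice is determined up to rotation by its minimal vectors. -/
lemma IsCriticalLattice.transpose_mul_self_eq_one [NeZero d] {g ρ : Matrix (Fin d) (Fin d) ℝ}
    (hg : IsCriticalLattice g) (hρg : IsCriticalLattice (ρ * g))
    (hS : minVecs g ⊆ minVecs (ρ * g)) : ρᵀ * ρ = 1 := by
  have hρ : ρ.det = 1 := by simpa [hg.1] using hρg.1
  have hu : IsUnit ρ := (isUnit_iff_isUnit_det ρ).mpr (by simp [hρ])
  refine eq_one_of_posDef_of_det_eq_one_of_trace_le ?_ (by simp [hρ]) ?_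
  · simpa using PosDef.conjTranspose_mul_self ρ (mulVec_injective_of_isUnit hu)
  · have htr := hg.trace_nonpos (K := ρᵀ * ρ - 1) fun m hm => by
      have h : eNorm (ρ *ᵥ (g *ᵥ intVec m)) = eNorm (g *ᵥ intVec m) := by
        rw [mulVec_mulVec, (hS hm).2, hm.2, hρg.shortestLen_eq hg]
      have h2 := congrArg (· ^ 2) h
      simp only [eNorm_sq] at h2
      rw [sub_mulVec, one_mulVec, dotProduct_sub, ← mulVec_mulVec, dotProduct_mulVec,
        vecMul_transpose, h2, sub_self]
    rw [trace_sub, trace_one, Fintype.card_fin] at htr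
    linarith

/-- The minimal vectors of a critical lattice span the ambient space. -/
lemma IsCriticalLattice.span_minVecs [NeZero d] {g : Matrix (Fin d) (Fin d) ℝ}
    (hg : IsCriticalLattice g) :
    Submodule.span ℝ ((fun m => g *ᵥ intVec m) '' minVecs g) = ⊤ := by
  by_contra hne
  obtain ⟨f, hf0, hf⟩ := Submodule.exists_le_ker_of_lt_top _ (lt_top_iff_ne_top.mpr hne)
  set l : Fin d → ℝ := fun i => f (Pi.single i 1)
  have hfl (v : Fin d → ℝ) : f v = l ⬝ᵥ v := by
    rw [LinearMap.pi_apply_eq_sum_univ f v, dotProduct]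
    exact Finset.sum_congr rfl fun i _ => by
      rw [smul_eq_mul, mul_comm]
      congr 2
      ext j
      simp [Pi.single_apply, eq_comm]
  have htr := hg.trace_nonpos (K := vecMulVec l l) fun m hm => by
    have h0 : f (g *ᵥ intVec m) = 0 := hf (Submodule.subset_span ⟨m, hm, rfl⟩)
    rw [hfl] at h0
    simp only [vecMulVec_mulVec, h0, MulOpposite.op_zero, zero_smul, dotProduct_zero, le_refl]
  rw [trace_vecMulVec] at htr
  have hl : l = 0 := dotProduct_self_eq_zero.mp (le_antisymm htr (by
    rw [← eNorm_sq]
    positivity))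
  exact hf0 (LinearMap.ext fun v => by simp [hfl, hl])

lemma mulVec_intVec_col (g : Matrix (Fin d) (Fin d) ℝ) (M : Matrix (Fin d) (Fin d) ℤ)
    (j : Fin d) : g *ᵥ intVec (M.col j) = (g * M.map (Int.castRingHom ℝ)).col j := by
  ext i
  simp [intVec, mulVec, dotProduct, mul_apply]

lemma map_intCast_mulVec_intVec (M : Matrix (Fin d) (Fin d) ℤ) (m : Fin d → ℤ) :
    M.map (Int.castRingHom ℝ) *ᵥ intVec m = intVec (M *ᵥ m) := by
  ext i
  simp [intVec, mulVec, dotProduct]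

lemma det_map_intCast (M : Matrix (Fin d) (Fin d) ℤ) :
    (M.map (Int.castRingHom ℝ)).det = (M.det : ℝ) :=
  ((Int.castRingHom ℝ).map_det M).symm

lemma IsCriticalLattice.exists_minVecs_frame [NeZero d] {g : Matrix (Fin d) (Fin d) ℝ}
    (hg : IsCriticalLattice g) :
    ∃ M : Matrix (Fin d) (Fin d) ℤ, M.det ≠ 0 ∧ ∀ j, M.col j ∈ minVecs g := by
  obtain ⟨b, hbS, hbspan, hbli⟩ :=
    exists_linearIndependent ℝ ((fun m => g *ᵥ intVec m) '' minVecs g)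
  rw [hg.span_minVecs] at hbspan
  let B : Module.Basis b ℝ (Fin d → ℝ) :=
    Module.Basis.mk hbli (by rw [Subtype.range_coe, hbspan])
  let e : Fin d ≃ b := (Pi.basisFun ℝ (Fin d)).indexEquiv B
  choose m hm hmb using fun j => hbS (e j).2
  refine ⟨(of m)ᵀ, ?_, hm⟩
  have hcol : (g * (of m)ᵀ.map (Int.castRingHom ℝ)).col = fun j => (e j : Fin d → ℝ) := by
    funext j
    rw [← mulVec_intVec_col]
    exact hmb j
  have hli := hbli.comp e e.injective
  rw [Function.comp_def, ← hcol] at hli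
  have hunit := linearIndependent_cols_iff_isUnit.mp hli
  have hdet := ((isUnit_iff_isUnit_det _).mp hunit).ne_zero
  rw [det_mul, hg.1, one_mul, det_map_intCast] at hdet
  exact_mod_cast hdet

lemma mulVec_ne_zero_of_det_ne_zero {M : Matrix (Fin d) (Fin d) ℤ} (hM : M.det ≠ 0)
    {m : Fin d → ℤ} (hm : m ≠ 0) : M *ᵥ m ≠ 0 :=
  fun h => hm (eq_zero_of_mulVec_eq_zero hM h)

lemma IsCriticalLattice.mul_intCast [NeZero d] {g : Matrix (Fin d) (Fin d) ℝ}
    (hg : IsCriticalLattice g) {γ : Matrix (Fin d) (Fin d) ℤ} (hγ : γ.det = 1) :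
    IsCriticalLattice (g * γ.map (Int.castRingHom ℝ)) := by
  refine ⟨by rw [det_mul, hg.1, det_map_intCast, hγ]; simp, fun g' hg' =>
    (hg.2 g' hg').trans (le_shortestLen fun m hm => ?_)⟩
  rw [← mulVec_mulVec, map_intCast_mulVec_intVec]
  exact shortestLen_le g (mulVec_ne_zero_of_det_ne_zero (by simp [hγ]) hm)

lemma latticePts_mul_intCast (g : Matrix (Fin d) (Fin d) ℝ) {γ : Matrix (Fin d) (Fin d) ℤ}
    (hγ : γ.det = 1) : latticePts (g * γ.map (Int.castRingHom ℝ)) = latticePts g := by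
  ext v
  constructor
  · rintro ⟨m, rfl⟩
    exact ⟨γ *ᵥ m, by rw [← mulVec_mulVec, map_intCast_mulVec_intVec]⟩
  · rintro ⟨m, rfl⟩
    refine ⟨γ.adjugate *ᵥ m, ?_⟩
    rw [← mulVec_mulVec, map_intCast_mulVec_intVec, mulVec_mulVec, mul_adjugate, hγ, one_smul,
      one_mulVec]

/-- Integer matrices with the same determinant `N` that agree modulo `N` have the same column
lattice up to a unimodular change of coordinates. -/
lemma exists_det_one_mul_eq {M₁ M₂ : Matrix (Fin d) (Fin d) ℤ} (h0 : M₁.det ≠ 0)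
    (hdet : M₂.det = M₁.det) (hmod : ∀ i j, M₁.det ∣ M₂ i j - M₁ i j) :
    ∃ γ : Matrix (Fin d) (Fin d) ℤ, γ.det = 1 ∧ γ * M₁ = M₂ := by
  choose X hX using hmod
  have hmul : (1 + of X * M₁.adjugate) * M₁ = M₂ := by
    rw [add_mul, one_mul, Matrix.mul_assoc, adjugate_mul, mul_smul_comm,
      mul_one]
    ext i j
    rw [Matrix.add_apply, Matrix.smul_apply, of_apply, smul_eq_mul, ← hX, add_sub_cancel]
  refine ⟨1 + of X * M₁.adjugate, ?_, hmul⟩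
  have h := congrArg det hmul
  rw [det_mul, hdet] at h
  exact (mul_eq_right₀ h0).mp h

lemma exists_rotation_of_frames [NeZero d] {g₁ g₂ : Matrix (Fin d) (Fin d) ℝ}
    (hg₁ : IsCriticalLattice g₁) (hg₂ : IsCriticalLattice g₂)
    {M₁ M₂ : Matrix (Fin d) (Fin d) ℤ} (h0 : M₁.det ≠ 0)
    (hdet : M₂.det = M₁.det) (hmod : ∀ i j, M₁.det ∣ M₂ i j - M₁ i j)
    (hT : (M₁.adjugate *ᵥ ·) '' minVecs g₁ = (M₂.adjugate *ᵥ ·) '' minVecs g₂) :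
    ∃ ρ : Matrix (Fin d) (Fin d) ℝ, ρᵀ * ρ = 1 ∧ ρ.det = 1 ∧
      latticePts g₂ = latticePts (ρ * g₁) := by
  obtain ⟨γ, hγ, hγM⟩ := exists_det_one_mul_eq h0 hdet hmod
  set g₃ := g₂ * γ.map (Int.castRingHom ℝ) with hg₃_def
  have hg₃ : IsCriticalLattice g₃ := hg₂.mul_intCast hγ
  have hadj : M₂.adjugate * γ = M₁.adjugate := by
    rw [← hγM, adjugate_mul_distrib, Matrix.mul_assoc, adjugate_mul, hγ, one_smul, mul_one]
  have hsub : minVecs g₁ ⊆ minVecs g₃ := by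
    intro m hm
    obtain ⟨n, hn, hnm⟩ : M₁.adjugate *ᵥ m ∈ (M₂.adjugate *ᵥ ·) '' minVecs g₂ :=
      hT ▸ ⟨m, hm, rfl⟩
    have hnγ : n = γ *ᵥ m := by
      have h : M₂ *ᵥ (M₂.adjugate *ᵥ n) = M₂ *ᵥ (M₂.adjugate *ᵥ (γ *ᵥ m)) := by
        rw [mulVec_mulVec m M₂.adjugate, hadj]
        exact congrArg (M₂ *ᵥ ·) hnm
      simp only [mulVec_mulVec n, mulVec_mulVec (γ *ᵥ m), mul_adjugate, smul_mulVec,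
        one_mulVec, hdet] at h
      exact smul_right_injective _ h0 h
    refine ⟨hm.1, ?_⟩
    rw [hg₃_def, ← mulVec_mulVec, map_intCast_mulVec_intVec, ← hnγ, hn.2, ← hg₃_def,
      hg₂.shortestLen_eq hg₃]
  have hρ : g₃ * g₁.adjugate * g₁ = g₃ := by
    rw [Matrix.mul_assoc, adjugate_mul, hg₁.1, one_smul, mul_one]
  refine ⟨g₃ * g₁.adjugate, ?_, ?_, ?_⟩
  · exact hg₁.transpose_mul_self_eq_one (hρ.symm ▸ hg₃) (hρ.symm ▸ hsub)
  · simp [det_adjugate, hg₁.1, hg₃.1]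
  · rw [hρ, latticePts_mul_intCast g₂ hγ]

/-- The discrete invariants of a lattice `g` with a frame `M` of integer vectors: the determinant
of `M`, the residues of `M` modulo it, and the minimal vectors in scaled frame coordinates. -/
def frameInvariant (g : Matrix (Fin d) (Fin d) ℝ) (M : Matrix (Fin d) (Fin d) ℤ) :
    ℤ × (Fin d → Fin d → ℤ) × Set (Fin d → ℤ) :=
  (M.det, fun i j => M i j % M.det, (M.adjugate *ᵥ ·) '' minVecs g)

lemma exists_bound_det_adjugate (r : ℝ) :
    ∃ B : ℤ, ∀ (h : Matrix (Fin d) (Fin d) ℝ) (v : Fin d → ℝ), (∀ i j, |h i j| ≤ r) →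
      (∀ i, |v i| ≤ r) → |h.det| ≤ B ∧ ∀ i, |(h.adjugate *ᵥ v) i| ≤ B := by
  have hcont : Continuous fun x : (Fin d → Fin d → ℝ) × (Fin d → ℝ) =>
      ((of x.1).det, (of x.1).adjugate *ᵥ x.2) := by
    have h1 : Continuous fun x : (Fin d → Fin d → ℝ) × (Fin d → ℝ) => of x.1 :=
      continuous_fst
    exact h1.matrix_det.prodMk (h1.matrix_adjugate.matrix_mulVec continuous_snd)
  obtain ⟨B, hB⟩ := (isCompact_Icc
    (a := ((fun _ _ => -r, fun _ => -r) : (Fin d → Fin d → ℝ) × (Fin d → ℝ)))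
    (b := (fun _ _ => r, fun _ => r))).exists_bound_of_continuousOn hcont.continuousOn
  refine ⟨⌈B⌉, fun h v hh hv => ?_⟩
  have hle := (hB (h, v) ⟨⟨fun i j => (abs_le.mp (hh i j)).1, fun i => (abs_le.mp (hv i)).1⟩,
    ⟨fun i j => (abs_le.mp (hh i j)).2, fun i => (abs_le.mp (hv i)).2⟩⟩).trans (Int.le_ceil B)
  rw [norm_prod_le_iff] at hle
  exact ⟨hle.1, fun i => (norm_le_pi_norm (h.adjugate *ᵥ v) i).trans hle.2⟩

lemma finite_frameInvariant (r : ℝ) :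
    {x | ∃ (g : Matrix (Fin d) (Fin d) ℝ) (M : Matrix (Fin d) (Fin d) ℤ), g.det = 1 ∧
      shortestLen g = r ∧ M.det ≠ 0 ∧ (∀ j, M.col j ∈ minVecs g) ∧
        frameInvariant g M = x}.Finite := by
  obtain ⟨B, hB⟩ := exists_bound_det_adjugate (d := d) r
  refine ((Set.finite_Icc (-B) B).prod ((Set.finite_Icc (fun _ _ : Fin d => (0 : ℤ))
    (fun _ _ => B)).prod (Set.finite_Icc (fun _ : Fin d => -B) (fun _ => B)).finite_subsets)
    ).subset ?_
  rintro _ ⟨g, M, hg, rfl, h0, hM, rfl⟩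
  set h := g * M.map (Int.castRingHom ℝ) with hh
  have hentry i j : |h i j| ≤ shortestLen g := by
    rw [← (hM j).2, mulVec_intVec_col]
    exact abs_apply_le_eNorm (h.col j) i
  have hmin {m : Fin d → ℤ} (hm : m ∈ minVecs g) i : |(g *ᵥ intVec m) i| ≤ shortestLen g :=
    (abs_apply_le_eNorm _ i).trans hm.2.le
  have hdetB : |M.det| ≤ B := by
    have hle : |h.det| ≤ B := by
      rcases isEmpty_or_nonempty (Fin d) with hd | ⟨⟨j⟩⟩
      · exact (hB h (fun i => hd.elim i) hentry fun i => hd.elim i).1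
      · exact (hB h _ hentry (hmin (hM j))).1
    rw [hh, det_mul, hg, one_mul, det_map_intCast] at hle
    exact_mod_cast hle
  refine ⟨abs_le.mp hdetB, ⟨fun i j => Int.emod_nonneg _ h0, fun i j =>
    ((Int.emod_lt_abs _ h0).le).trans hdetB⟩, ?_⟩
  rintro _ ⟨m, hm, rfl⟩
  have hadj : h.adjugate *ᵥ (g *ᵥ intVec m) = intVec (M.adjugate *ᵥ m) := by
    have hmap : (M.map (Int.castRingHom ℝ)).adjugate = M.adjugate.map (Int.castRingHom ℝ) :=
      ((Int.castRingHom ℝ).map_adjugate M).symm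
    rw [hh, mulVec_mulVec, adjugate_mul_distrib, Matrix.mul_assoc, adjugate_mul, hg, one_smul,
      mul_one, hmap, map_intCast_mulVec_intVec]
  have hle i : |(M.adjugate *ᵥ m) i| ≤ B := by
    have := (hB h _ hentry (hmin hm)).2 i
    rw [hadj] at this
    exact_mod_cast this
  exact ⟨fun i => (abs_le.mp (hle i)).1, fun i => (abs_le.mp (hle i)).2⟩

/-- Near a Euclidean-critical unimodular lattice, the only unimodular perturbations that
remain critical are rotations; consequently the critical locus is a finite union of
`SO(d)`-orbits. -/
theorem critical_locus_finite_union_SO_orbits :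
    (∀ g₀ : Matrix (Fin d) (Fin d) ℝ, IsCriticalLattice g₀ →
      ∃ U ∈ nhds (1 : Matrix (Fin d) (Fin d) ℝ), ∀ g ∈ U, g.det = 1 →
        IsCriticalLattice (g * g₀) → gᵀ * g = 1) ∧
    ∃ (k : ℕ) (reps : Fin k → Matrix (Fin d) (Fin d) ℝ),
      (∀ i, IsCriticalLattice (reps i)) ∧
      ∀ g : Matrix (Fin d) (Fin d) ℝ, IsCriticalLattice g →
        ∃ (i : Fin k) (ρ : Matrix (Fin d) (Fin d) ℝ), ρᵀ * ρ = 1 ∧ ρ.det = 1 ∧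
          latticePts g = latticePts (ρ * reps i) := by
  rcases eq_or_ne d 0 with rfl | hd
  · exact ⟨fun g₀ _ => ⟨Set.univ, Filter.univ_mem, fun g _ _ _ => Subsingleton.elim _ _⟩, 1,
      fun _ => 1, fun _ => ⟨det_one, fun g' _ => by rw [Subsingleton.elim g' 1]⟩,
      fun g _ => ⟨0, 1, Subsingleton.elim _ _, det_one, by rw [Subsingleton.elim g (1 * 1)]⟩⟩
  have : NeZero d := ⟨hd⟩
  refine ⟨fun g₀ hg₀ => ⟨_, shortestLen_lt_of_near_one hg₀, fun g hgU hgdet hgg₀ => ?_⟩, ?_⟩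
  · have hinv : g.adjugate * (g * g₀) = g₀ := by
      rw [← Matrix.mul_assoc, adjugate_mul, hgdet, one_smul, one_mul]
    have hsub : minVecs (g * g₀) ⊆ minVecs g₀ := by
      intro m hm
      by_contra hmin
      have hlt := hgU m hm.1 hmin
      rw [mulVec_mulVec, hm.2, hgg₀.shortestLen_eq hg₀] at hlt
      exact hlt.false
    have horth := hgg₀.transpose_mul_self_eq_one (ρ := g.adjugate) (hinv.symm ▸ hg₀)
      (hinv.symm ▸ hsub)
    have hadj : g.adjugate * g = 1 := by rw [adjugate_mul, hgdet, one_smul]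
    have hg : g = g.adjugateᵀ := by
      simpa [Matrix.mul_assoc, hadj] using congrArg (· * g) horth.symm
    have hgt : gᵀ = g.adjugate := by rw [congrArg transpose hg, transpose_transpose]
    rw [hgt, hadj]
  · choose M hM0 hM using fun g : {g : Matrix (Fin d) (Fin d) ℝ // IsCriticalLattice g} =>
      g.2.exists_minVecs_frame
    let F := fun g : {g : Matrix (Fin d) (Fin d) ℝ // IsCriticalLattice g} =>
      frameInvariant g.1 (M g)
    have hfin : (Set.range F).Finite := by
      rcases isEmpty_or_nonempty {g : Matrix (Fin d) (Fin d) ℝ // IsCriticalLattice g} with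
        hemp | ⟨⟨g₀⟩⟩
      · exact Set.finite_range F
      · refine (finite_frameInvariant (shortestLen g₀.1)).subset ?_
        rintro _ ⟨g, rfl⟩
        exact ⟨g, M g, g.2.1, g.2.shortestLen_eq g₀.2, hM0 g, hM g, rfl⟩
    have := hfin.to_subtype
    let e := Finite.equivFin (Set.range F)
    choose r hr using fun x : Set.range F => x.2
    refine ⟨_, fun i => (r (e.symm i)).1, fun i => (r (e.symm i)).2, fun g hg => ?_⟩
    let x : Set.range F := ⟨F ⟨g, hg⟩, Set.mem_range_self _⟩
    refine ⟨e x, ?_⟩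
    simp only [Equiv.symm_apply_apply]
    have hinv : F (r x) = F ⟨g, hg⟩ := hr x
    simp only [F, frameInvariant, Prod.mk.injEq] at hinv
    obtain ⟨hdet, hres, hT⟩ := hinv
    refine exists_rotation_of_frames (r x).2 hg (hM0 _) hdet.symm (fun i j => ?_) hT
    have hij := congrFun (congrFun hres i) j
    rw [← hdet] at hij
    exact Int.ModEq.dvd hij
end

section
/- For Lebesgue-almost every m×n real matrix A, the forward orbit {a_s u_A ℤ^{m+n} : s > 0} under the diagonal flow a_s = diag(e^{s/m} I_m, e^{−s/n} I_n) is dense in the space SL_{m+n}(ℝ)/SL_{m+n}(ℤ) of unimodular lattices. -/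
open Matrix MeasureTheory

noncomputable instance SLtop (m n : ℕ) :
    TopologicalSpace (Matrix.SpecialLinearGroup (Fin m ⊕ Fin n) ℝ) := by
  unfold Matrix.SpecialLinearGroup; infer_instance

noncomputable instance SLmeas (m n : ℕ) :
    MeasurableSpace (Matrix.SpecialLinearGroup (Fin m ⊕ Fin n) ℝ) := borel _

/-- the image of `SL_d(ℤ)` in `SL_d(ℝ)` -/
noncomputable def Γ (m n : ℕ) : Subgroup (Matrix.SpecialLinearGroup (Fin m ⊕ Fin n) ℝ) :=
  (Matrix.SpecialLinearGroup.map (n := Fin m ⊕ Fin n) (Int.castRingHom ℝ)).range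

open Filter Topology

theorem volume_norm_sum_zsmul_lt_le {n : ℕ} {q : Fin n → ℤ} (hq : q ≠ 0) (δ : ℝ) :
    volume {x : Fin n → UnitAddCircle | ‖∑ j, q j • x j‖ < δ} ≤ ENNReal.ofReal (2 * δ) := by
  let f : (Fin n → UnitAddCircle) →+ UnitAddCircle :=
    { toFun := fun x => ∑ j, q j • x j
      map_zero' := by simp
      map_add' := fun x y => by simp [Finset.sum_add_distrib] }
  have hcont : Continuous f := by
    change Continuous fun x : Fin n → UnitAddCircle => ∑ j, q j • x j
    fun_prop
  obtain ⟨j, hj⟩ := Function.ne_iff.1 hq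
  have hsurj : Function.Surjective f := by
    intro y
    refine ⟨Pi.single j (DivisibleBy.div y (q j)), ?_⟩
    change ∑ k, q k • (Pi.single j (DivisibleBy.div y (q j)) : Fin n → UnitAddCircle) k = y
    rw [Finset.sum_eq_single j (fun k _ hk => by simp [hk]) (by simp), Pi.single_eq_same]
    exact DivisibleBy.div_cancel y hj
  have hmp : MeasurePreserving f (volume : Measure (Fin n → UnitAddCircle)) volume :=
    AddMonoidHom.measurePreserving hcont hsurj (by
      rw [volume_pi, Measure.pi_univ]
      simp)
  calc volume {x : Fin n → UnitAddCircle | ‖∑ j, q j • x j‖ < δ}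
      ≤ volume (f ⁻¹' Metric.closedBall 0 δ) := by
        refine measure_mono fun x hx => ?_
        rw [Set.mem_preimage, mem_closedBall_zero_iff]
        exact le_of_lt hx
    _ = ENNReal.ofReal (min 1 (2 * δ)) := by
        rw [hmp.measure_preimage measurableSet_closedBall.nullMeasurableSet,
          AddCircle.volume_closedBall]
    _ ≤ _ := ENNReal.ofReal_le_ofReal (min_le_right _ _)

theorem volume_forall_norm_sum_zsmul_lt_le {m n : ℕ} {q : Fin n → ℤ} (hq : q ≠ 0) (δ : ℝ) :
    volume {X : Fin m → Fin n → UnitAddCircle | ∀ i, ‖∑ j, q j • X i j‖ < δ} ≤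
      ENNReal.ofReal (2 * δ) ^ m := by
  have : {X : Fin m → Fin n → UnitAddCircle | ∀ i, ‖∑ j, q j • X i j‖ < δ} =
      Set.univ.pi fun _ => {x : Fin n → UnitAddCircle | ‖∑ j, q j • x j‖ < δ} := by
    ext X
    simp
  rw [this, volume_pi_pi, Finset.prod_const, Finset.card_univ, Fintype.card_fin]
  exact pow_le_pow_left' (volume_norm_sum_zsmul_lt_le hq δ) m

/-- The torus matrices `X` for which `‖q‖ < c`, `‖X q‖ < δ` has a nonzero integer solution. -/
def approximableSet (m n : ℕ) (c δ : ℝ) : Set (Fin m → Fin n → UnitAddCircle) :=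
  {X | ∃ q : Fin n → ℤ, q ≠ 0 ∧ (∀ j, |(q j : ℝ)| < c) ∧ ∀ i, ‖∑ j, q j • X i j‖ < δ}

theorem volume_approximableSet_le {m n : ℕ} {c δ : ℝ} (hc : 1 ≤ c) (hδ : 0 ≤ δ) :
    volume (approximableSet m n c δ) ≤ ENNReal.ofReal ((3 * c) ^ n * (2 * δ) ^ m) := by
  classical
  let Q : Finset (Fin n → ℤ) :=
    (Fintype.piFinset fun _ => Finset.Icc (-⌊c⌋) ⌊c⌋).filter (· ≠ 0)
  have hfloor : 0 ≤ ⌊c⌋ := Int.floor_nonneg.2 (by linarith)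
  have hsub : approximableSet m n c δ ⊆
      ⋃ q ∈ Q, {X : Fin m → Fin n → UnitAddCircle | ∀ i, ‖∑ j, q j • X i j‖ < δ} := by
    rintro X ⟨q, hq0, hqc, hX⟩
    refine Set.mem_biUnion (x := q) ?_ hX
    simp only [Q, Finset.coe_filter, Set.mem_ofPred_eq, Fintype.mem_piFinset, Finset.mem_Icc]
    refine ⟨fun j => ?_, hq0⟩
    rw [← abs_le, Int.le_floor]
    exact_mod_cast (hqc j).le
  have hcard : (Q.card : ℝ) ≤ (3 * c) ^ n := by
    calc (Q.card : ℝ) ≤ ((Fintype.piFinset fun _ : Fin n => Finset.Icc (-⌊c⌋) ⌊c⌋).card : ℝ) := by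
          exact_mod_cast Finset.card_filter_le _ _
      _ = ((⌊c⌋ + 1 - -⌊c⌋).toNat : ℝ) ^ n := by simp
      _ ≤ (3 * c) ^ n := by
          gcongr
          rw [← Int.cast_natCast, Int.toNat_of_nonneg (by linarith)]
          push_cast
          linarith [Int.floor_le c]
  calc volume (approximableSet m n c δ)
      ≤ ∑ q ∈ Q, volume {X : Fin m → Fin n → UnitAddCircle | ∀ i, ‖∑ j, q j • X i j‖ < δ} :=
        (measure_mono hsub).trans (measure_biUnion_finset_le _ _)
    _ ≤ ∑ q ∈ Q, ENNReal.ofReal (2 * δ) ^ m := Finset.sum_le_sum fun q hq =>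
        volume_forall_norm_sum_zsmul_lt_le (Finset.mem_filter.1 hq).2 δ
    _ = ENNReal.ofReal (Q.card * (2 * δ) ^ m) := by
        rw [Finset.sum_const, nsmul_eq_mul, ENNReal.ofReal_mul (p := (Q.card : ℝ)) (by positivity),
          ENNReal.ofReal_natCast, ENNReal.ofReal_pow (by positivity)]
    _ ≤ _ := ENNReal.ofReal_le_ofReal (by gcongr)

theorem measure_setOf_eventually_mem_le {α : Type*} [MeasurableSpace α] {μ : Measure α}
    {E : ℕ → Set α} {b : ENNReal} (h : ∀ᶠ k in atTop, μ (E k) ≤ b) :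
    μ {x | ∀ᶠ k in atTop, x ∈ E k} ≤ b := by
  have : {x | ∀ᶠ k in atTop, x ∈ E k} = ⋃ K, ⋂ k ≥ K, E k := by
    ext x
    simp [eventually_atTop]
  rw [this, Monotone.measure_iUnion]
  · refine iSup_le fun K => ?_
    obtain ⟨k, hk, hkK⟩ := (h.and (eventually_ge_atTop K)).exists
    exact (measure_mono (Set.biInter_subset_of_mem hkK)).trans hk
  · intro K L hKL
    exact Set.biInter_mono (fun k hk => le_trans hKL hk) fun _ _ => le_rfl

theorem ae_torus_exists_frequently_notMem_approximableSet {m n : ℕ} (hm : 0 < m) (hn : 0 < n) :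
    ∀ᵐ X : Fin m → Fin n → UnitAddCircle, ∃ ε : ℝ, 0 < ε ∧ ε ≤ 1 ∧ ∃ᶠ k : ℕ in atTop,
      X ∉ approximableSet m n (ε * Real.exp (k / n)) (ε * Real.exp (-(k / m))) := by
  have hbound : ∀ ε : ℝ, 0 < ε → ε ≤ 1 →
      volume {X : Fin m → Fin n → UnitAddCircle | ∀ᶠ k : ℕ in atTop,
        X ∈ approximableSet m n (ε * Real.exp (k / n)) (ε * Real.exp (-(k / m)))} ≤
      ENNReal.ofReal (3 ^ n * 2 ^ m * ε) := by
    intro ε hε hε1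
    apply measure_setOf_eventually_mem_le
    have hlim : Tendsto (fun k : ℕ => ε * Real.exp (k / n)) atTop atTop :=
      (Real.tendsto_exp_atTop.comp (tendsto_natCast_atTop_atTop.atTop_div_const
        (by exact_mod_cast hn))).const_mul_atTop hε
    filter_upwards [hlim.eventually_ge_atTop 1] with k hk
    refine (volume_approximableSet_le hk (by positivity)).trans (ENNReal.ofReal_le_ofReal ?_)
    have h1 : Real.exp ((k : ℝ) / n) ^ n = Real.exp k := by
      rw [← Real.exp_nat_mul]; congr 1; field_simp
    have h2 : Real.exp (-((k : ℝ) / m)) ^ m = Real.exp (-k) := by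
      rw [← Real.exp_nat_mul]; congr 1; field_simp
    have h3 : Real.exp k * Real.exp (-(k : ℝ)) = 1 := by rw [← Real.exp_add]; simp
    calc (3 * (ε * Real.exp ((k : ℝ) / n))) ^ n * (2 * (ε * Real.exp (-((k : ℝ) / m)))) ^ m
        = 3 ^ n * 2 ^ m * ε ^ (n + m) * (Real.exp ((k : ℝ) / n) ^ n *
            Real.exp (-((k : ℝ) / m)) ^ m) := by ring
      _ = 3 ^ n * 2 ^ m * ε ^ (n + m) := by rw [h1, h2, h3, mul_one]
      _ ≤ 3 ^ n * 2 ^ m * ε := by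
          gcongr
          exact pow_le_of_le_one hε.le hε1 (by omega)
  rw [ae_iff]
  refine le_antisymm (ENNReal.le_of_forall_pos_le_add fun η hη _ => ?_) zero_le
  rw [zero_add]
  set ε : ℝ := min 1 (η / (3 ^ n * 2 ^ m)) with hε_def
  have hε : 0 < ε := lt_min one_pos (div_pos (by exact_mod_cast hη) (by positivity))
  refine (measure_mono fun X hX => ?_).trans ((hbound ε hε (min_le_left _ _)).trans ?_)
  · by_contra hcon
    exact hX ⟨ε, hε, min_le_left _ _, not_eventually.1 hcon⟩
  · rw [← ENNReal.ofReal_coe_nnreal]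
    apply ENNReal.ofReal_le_ofReal
    calc 3 ^ n * 2 ^ m * ε ≤ 3 ^ n * 2 ^ m * (η / (3 ^ n * 2 ^ m)) := by
          gcongr; exact min_le_right _ _
      _ = η := by field_simp

theorem ae_matrix_of_ae_torus {m n : ℕ} {P : (Fin m → Fin n → UnitAddCircle) → Prop}
    (h : ∀ᵐ X, P X) :
    ∀ᵐ A : Fin m → Fin n → ℝ, P fun i j => (A i j : UnitAddCircle) := by
  let box : (Fin m → Fin n → ℤ) → Set (Fin m → Fin n → ℝ) := fun t =>
    Set.univ.pi fun i => Set.univ.pi fun j => Set.Ioc (t i j : ℝ) (t i j + 1)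
  have hbox : ∀ t, ∀ᵐ A ∂(volume.restrict (box t)), P fun i j => (A i j : UnitAddCircle) := by
    intro t
    have hmp : MeasurePreserving (fun (A : Fin m → Fin n → ℝ) i j => (A i j : UnitAddCircle))
        (volume.restrict (box t)) volume := by
      simp only [box, volume_pi]
      simp only [Measure.restrict_pi_pi]
      exact measurePreserving_pi _ _ fun i => measurePreserving_pi _ _ fun j =>
        UnitAddCircle.measurePreserving_mk (t i j)
    exact hmp.quasiMeasurePreserving.ae h
  have hcover : ⋃ t, box t = Set.univ := by
    refine Set.eq_univ_of_forall fun A => Set.mem_iUnion.2 ⟨fun i j => ⌈A i j⌉ - 1, ?_⟩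
    intro i _ j _
    push_cast
    exact ⟨by linarith [Int.ceil_lt_add_one (A i j)], by linarith [Int.le_ceil (A i j)]⟩
  have := (ae_restrict_iUnion_iff box _).2 hbox
  rwa [hcover, Measure.restrict_univ] at this

theorem exists_int_mulVec_abs_lt {ι : Type*} [Fintype ι] [DecidableEq ι]
    (B : Matrix ι ι ℝ) (hB : B.det = 1) (c : ι → ℝ) (hc : ∀ i, 0 < c i)
    (hprod : 1 < ∏ i, c i) :
    ∃ z : ι → ℤ, z ≠ 0 ∧ ∀ i, |(B *ᵥ fun j => (z j : ℝ)) i| < c i := by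
  let s : Set (ι → ℝ) := Matrix.toLin' B ⁻¹' Set.univ.pi fun i => Set.Ioo (-c i) (c i)
  have hdet : LinearMap.det (Matrix.toLin' B) = 1 := by rw [LinearMap.det_toLin', hB]
  have hvol : volume s = ∏ i, ENNReal.ofReal (2 * c i) := by
    rw [Measure.addHaar_preimage_linearMap _ (by rw [hdet]; exact one_ne_zero), hdet,
      Real.volume_pi_Ioo]
    simp [two_mul]
  have hsymm : ∀ x ∈ s, -x ∈ s := by
    intro x hx i _
    have := hx i trivial
    simp only [map_neg, Pi.neg_apply, Set.mem_Ioo] at this ⊢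
    constructor <;> linarith [this.1, this.2]
  have hconv : Convex ℝ s :=
    (convex_pi fun i _ => convex_Ioo _ _).linear_preimage _
  have fund := ZSpan.isAddFundamentalDomain' (Pi.basisFun ℝ ι) volume
  have : Countable (Submodule.span ℤ (Set.range (Pi.basisFun ℝ ι))).toAddSubgroup :=
    inferInstanceAs (Countable (Submodule.span ℤ (Set.range (Pi.basisFun ℝ ι))))
  obtain ⟨x, hx0, hxs⟩ := exists_ne_zero_mem_lattice_of_measure_mul_two_pow_lt_measure
    fund hsymm hconv (by
      rw [hvol, ZSpan.volume_fundamentalDomain, ← ENNReal.ofReal_prod_of_nonneg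
        (fun i _ => by have := hc i; positivity), Finset.prod_mul_distrib]
      have h1 : (Matrix.of ⇑(Pi.basisFun ℝ ι)).det = 1 := by
        convert Matrix.det_one (n := ι) (R := ℝ)
        ext i j
        simp [Matrix.one_apply, Pi.single_apply, eq_comm]
      rw [h1]
      simp only [abs_one, ENNReal.ofReal_one, one_mul, Module.finrank_fintype_fun_eq_card,
        Finset.prod_const, Finset.card_univ]
      rw [← ENNReal.ofReal_ofNat, ← ENNReal.ofReal_pow (by norm_num)]
      apply (ENNReal.ofReal_lt_ofReal_iff (by positivity)).2
      have : (0:ℝ) < 2 ^ Fintype.card ι := by positivity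
      nlinarith)
  have hmem : ∀ i, ∃ k : ℤ, (k : ℝ) = (x : ι → ℝ) i := by
    have := ((Pi.basisFun ℝ ι).mem_span_iff_repr_mem ℤ (x : ι → ℝ)).1 x.2
    intro i
    simpa using this i
  choose z hz using hmem
  refine ⟨z, ?_, fun i => ?_⟩
  · rintro rfl
    apply hx0
    ext i
    simp [← hz i]
  · have := hxs i trivial
    rw [abs_lt, funext hz]
    exact this

theorem exists_int_matrix_mul_bounded {ι : Type*} [Fintype ι] [DecidableEq ι] [Nonempty ι]
    {ε : ℝ} (hε : 0 < ε) :
    ∃ R : ℝ, ∀ g : Matrix ι ι ℝ, g.det = 1 →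
      (∀ z : ι → ℤ, z ≠ 0 → ε ≤ ‖g *ᵥ fun j => (z j : ℝ)‖) →
      ∃ N : Matrix ι ι ℤ, N.det ≠ 0 ∧ ∀ i j, |(g * N.map (Int.cast : ℤ → ℝ)) i j| ≤ R := by
  have hd : 0 < (Fintype.card ι : ℝ) := by exact_mod_cast Fintype.card_pos
  set d : ℝ := (Fintype.card ι : ℝ) with hd_def
  set e : ℝ := ε / d with he
  have hepos : 0 < e := by positivity
  have hde : d * e = ε := by rw [he]; field_simp
  set T : ℝ := 2 / e ^ (Fintype.card ι - 1) with hT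
  have hTpos : 0 < T := by positivity
  refine ⟨T + ε, fun g hg hmin => ?_⟩
  let S : Set (ι → ℝ) := {x | ‖x‖ ≤ T + ε ∧ ∃ z : ι → ℤ, x = g *ᵥ fun j => (z j : ℝ)}
  by_cases hspan : Submodule.span ℝ S = ⊤
  · let b := Module.Basis.ofSpan hspan.ge
    let b' := b.reindex (b.indexEquiv (Pi.basisFun ℝ ι))
    have hb : ∀ j, b' j ∈ S := fun j => by
      rw [Module.Basis.reindex_apply]
      exact Module.Basis.ofSpan_subset hspan.ge ⟨_, rfl⟩
    choose hbR z hz using hb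
    have hgN : g * (Matrix.of fun i j => z j i).map (Int.cast : ℤ → ℝ) =
        Matrix.of fun i j => b' j i := by
      ext i j
      rw [Matrix.of_apply, hz j]
      rfl
    refine ⟨Matrix.of fun i j => z j i, fun h0 => ?_, fun i j => ?_⟩
    · have hu : IsUnit (Matrix.of fun i j => b' j i) :=
        Matrix.linearIndependent_cols_iff_isUnit.1 b'.linearIndependent
      rw [Matrix.isUnit_iff_isUnit_det, ← hgN, Matrix.det_mul, ← Int.cast_det, h0] at hu
      simp at hu
    · rw [hgN, Matrix.of_apply, ← Real.norm_eq_abs]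
      exact (norm_le_pi_norm _ _).trans (hbR j)
  · exfalso
    obtain ⟨f, hf0, hf⟩ := Submodule.exists_le_ker_of_lt_top _ (lt_top_iff_ne_top.2 hspan)
    have hfS : ∀ x ∈ S, f x = 0 := fun x hx => hf (Submodule.subset_span hx)
    let v : ι → ℝ := fun i => f (Pi.single i 1)
    have hfv : ∀ x, f x = ∑ i, v i * x i := fun x => by
      rw [LinearMap.pi_apply_eq_sum_univ f x]
      exact Finset.sum_congr rfl fun i _ => by
        rw [smul_eq_mul, mul_comm]; congr 2; ext j; simp [Pi.single_apply, eq_comm]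
    obtain ⟨j, hj⟩ := Finite.exists_max fun i => |v i|
    have hvj : v j ≠ 0 := by
      intro h
      apply hf0
      ext i
      have := hj i
      rw [h, abs_zero] at this
      simpa using abs_nonpos_iff.1 this
    let w : ι → ℝ := fun i => v i / v j
    have hw1 : ∀ i, |w i| ≤ 1 := fun i => by
      rw [abs_div]; exact div_le_one_of_le₀ (hj i) (abs_nonneg _)
    have hwj : w j = 1 := div_self hvj
    have hfw : ∀ x, f x = 0 → ∑ i, w i * x i = 0 := fun x hx => by
      rw [hfv] at hx
      calc ∑ i, w i * x i = (∑ i, v i * x i) / v j := by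
            rw [Finset.sum_div]; exact Finset.sum_congr rfl fun i _ => by simp only [w]; ring
        _ = 0 := by rw [hx, zero_div]
    let M : Matrix ι ι ℝ := (1 : Matrix ι ι ℝ).updateRow j w
    have hM : M.det = 1 := by
      have := Matrix.det_updateRow_sum (1 : Matrix ι ι ℝ) j w
      simp only [hwj, Matrix.det_one, smul_eq_mul, mul_one] at this
      have hrow : ∑ k, w k • (1 : Matrix ι ι ℝ) k = w := by
        ext k
        rw [Finset.sum_apply]
        simp [Matrix.one_apply]
      rwa [hrow] at this
    have hMx : ∀ x i, (M *ᵥ x) i = if i = j then ∑ k, w k * x k else x i := by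
      intro x i
      by_cases h : i = j
      · subst h; simp [M, Matrix.mulVec, dotProduct]
      · simp [M, Matrix.mulVec, dotProduct, h, Matrix.one_apply]
    obtain ⟨z, hz0, hz⟩ := exists_int_mulVec_abs_lt (M * g)
      (by rw [Matrix.det_mul, hM, hg, one_mul])
      (fun i => if i = j then T else e) (fun i => by split_ifs <;> assumption) (by
        rw [Finset.prod_ite]
        simp only [Finset.prod_const, Finset.filter_eq', Finset.mem_univ, if_true,
          Finset.card_singleton, pow_one, Finset.filter_ne', Finset.card_erase_of_mem,
          Finset.card_univ]
        rw [hT, div_mul_cancel₀ _ (by positivity)]; norm_num)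
    set x := g *ᵥ fun j => (z j : ℝ)
    have hx : ∀ i, |(M *ᵥ x) i| < if i = j then T else e := fun i => by
      simpa [x, Matrix.mulVec_mulVec] using hz i
    have hxi : ∀ i, i ≠ j → |x i| < e := fun i hi => by simpa [hMx, hi] using hx i
    have hrest : |∑ i ∈ Finset.univ.erase j, w i * x i| ≤ (d - 1) * e := by
      refine (Finset.abs_sum_le_sum_abs _ _).trans ?_
      refine (Finset.sum_le_card_nsmul _ _ e fun i hi => ?_).trans ?_
      · rw [abs_mul]
        have := hxi i (Finset.ne_of_mem_erase hi)
        nlinarith [hw1 i, abs_nonneg (x i), abs_nonneg (w i)]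
      · rw [Finset.card_erase_of_mem (Finset.mem_univ j), Finset.card_univ, nsmul_eq_mul,
          Nat.cast_sub Fintype.card_pos, Nat.cast_one]
    have hsum : ∑ i, w i * x i = x j + ∑ i ∈ Finset.univ.erase j, w i * x i := by
      rw [← Finset.add_sum_erase _ _ (Finset.mem_univ j), hwj, one_mul]
    have hxj : |∑ i, w i * x i| < T := by simpa [hMx] using hx j
    have hd1 : 1 ≤ d := by
      rw [hd_def]; exact_mod_cast Nat.succ_le_of_lt (Fintype.card_pos : 0 < Fintype.card ι)
    have heε : e ≤ ε := by nlinarith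
    have hxR : ‖x‖ ≤ T + ε := by
      rw [pi_norm_le_iff_of_nonneg (by positivity)]
      intro i
      rw [Real.norm_eq_abs]
      by_cases h : i = j
      · subst h
        rw [hsum] at hxj
        rw [abs_le] at hrest ⊢
        rw [abs_lt] at hxj
        constructor <;> nlinarith
      · linarith [hxi i h]
    have h0 := hfw x (hfS x ⟨hxR, z, rfl⟩)
    have : ‖x‖ < ε := by
      rw [pi_norm_lt_iff hε]
      intro i
      rw [Real.norm_eq_abs]
      by_cases h : i = j
      · subst h
        rw [hsum] at h0
        rw [abs_le] at hrest
        rw [abs_lt]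
        constructor <;> nlinarith
      · linarith [hxi i h]
    exact absurd this (not_lt.2 (hmin z hz0))

theorem exists_specialLinearGroup_mul_eq {ι : Type*} [Fintype ι] [DecidableEq ι]
    {M N : Matrix ι ι ℤ} {D : ℤ} (hD : D ≠ 0) (hM : M.det = D) (hN : N.det = D)
    (hmod : ∀ i j, M i j % D = N i j % D) :
    ∃ γ : Matrix.SpecialLinearGroup ι ℤ, (γ : Matrix ι ι ℤ) * M = N := by
  have hdvd : ∀ i j, ∃ e, N i j = M i j + D * e := fun i j => by
    obtain ⟨e, he⟩ := Int.ModEq.dvd (hmod i j)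
    exact ⟨e, by linarith⟩
  choose E hE using hdvd
  have hNE : N = M + D • Matrix.of E := by
    ext i j
    simp [hE]
  have hmul : (1 + Matrix.of E * M.adjugate) * M = N := by
    rw [add_mul, one_mul, Matrix.mul_assoc, Matrix.adjugate_mul, hM, hNE, Matrix.mul_smul,
      Matrix.mul_one]
  refine ⟨⟨1 + Matrix.of E * M.adjugate, ?_⟩, hmul⟩
  have := congrArg Matrix.det hmul
  rw [Matrix.det_mul, hM, hN] at this
  exact mul_right_cancel₀ hD (by rw [this, one_mul])

/-- A sequential form of **Mahler's compactness criterion**. -/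
theorem exists_subseq_tendsto_mul_specialLinearGroup_int {ι : Type*} [Fintype ι] [DecidableEq ι]
    [Nonempty ι] {ε : ℝ} (hε : 0 < ε) (g : ℕ → Matrix ι ι ℝ) (hg : ∀ k, (g k).det = 1)
    (hmin : ∀ k, ∀ z : ι → ℤ, z ≠ 0 → ε ≤ ‖g k *ᵥ fun j => (z j : ℝ)‖) :
    ∃ φ : ℕ → ℕ, StrictMono φ ∧ ∃ γ : ℕ → Matrix.SpecialLinearGroup ι ℤ, ∃ x : Matrix ι ι ℝ,
      Tendsto (fun k => g (φ k) * (γ k : Matrix ι ι ℤ).map (Int.cast : ℤ → ℝ)) atTop (𝓝 x) := by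
  obtain ⟨R, hR⟩ := exists_int_matrix_mul_bounded (ι := ι) hε
  choose N hN0 hNR using fun k => hR (g k) (hg k) (hmin k)
  obtain ⟨C, hC⟩ : ∃ C : ℤ, ∀ k, |(N k).det| ≤ C := by
    refine ⟨⌈(Nat.factorial (Fintype.card ι) • R ^ Fintype.card ι : ℝ)⌉, fun k => ?_⟩
    have h := Matrix.det_le (abv := (AbsoluteValue.abs : AbsoluteValue ℝ ℝ)) (hNR k)
    rw [Matrix.det_mul, hg, one_mul, ← Int.cast_det] at h
    have h2 : |((N k).det : ℝ)| ≤ _ := h.trans (Int.le_ceil _)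
    exact_mod_cast h2
  have hmem : ∀ k i j, N k i j % (N k).det ∈ Set.Icc 0 C := fun k i j =>
    ⟨Int.emod_nonneg _ (hN0 k), ((Int.emod_lt_abs _ (hN0 k)).trans_le (hC k)).le⟩
  let F : ℕ → Set.Icc (-C) C × (ι → ι → Set.Icc 0 C) := fun k =>
    (⟨(N k).det, abs_le.1 (hC k)⟩, fun i j => ⟨N k i j % (N k).det, hmem k i j⟩)
  obtain ⟨y, hy⟩ := Finite.exists_infinite_fiber F
  obtain ⟨φ, hφ, hφy⟩ := extraction_of_frequently_atTop
    (Nat.frequently_atTop_iff_infinite.2 (Set.infinite_coe_iff.1 hy))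
  have hF : ∀ k, F (φ k) = F (φ 0) := fun k => (hφy k).trans (hφy 0).symm
  have hdet : ∀ k, (N (φ k)).det = (N (φ 0)).det := fun k =>
    congrArg Subtype.val (congrArg Prod.fst (hF k))
  have hmod : ∀ k i j, N (φ 0) i j % (N (φ 0)).det = N (φ k) i j % (N (φ 0)).det :=
    fun k i j => by
      have := congrArg Subtype.val (congrFun (congrFun (congrArg Prod.snd (hF k)) i) j)
      simp only [F, hdet] at this
      exact this.symm
  choose γ hγ using fun k => exists_specialLinearGroup_mul_eq (hN0 (φ 0)) rfl (hdet k) (hmod k)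
  have hK : IsCompact (Set.univ.pi fun _ : ι => Set.univ.pi fun _ : ι => Set.Icc (-R) R) :=
    isCompact_univ_pi fun _ => isCompact_univ_pi fun _ => isCompact_Icc
  obtain ⟨x, -, ψ, hψ, hx⟩ := hK.tendsto_subseq
    (x := fun k i j => (g (φ k) * (N (φ k)).map (Int.cast : ℤ → ℝ)) i j)
    (fun k i _ j _ => abs_le.1 (hNR (φ k) i j))
  let N₀ : Matrix ι ι ℝ := (N (φ 0)).map (Int.cast : ℤ → ℝ)
  have hu : IsUnit N₀.det := by
    rw [isUnit_iff_ne_zero, ← Int.cast_det]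
    exact_mod_cast hN0 (φ 0)
  refine ⟨φ ∘ ψ, hφ.comp hψ, γ ∘ ψ, Matrix.of x * N₀⁻¹, ?_⟩
  have heq : ∀ k, g (φ k) * (γ k : Matrix ι ι ℤ).map (Int.cast : ℤ → ℝ) =
      g (φ k) * (N (φ k)).map (Int.cast : ℤ → ℝ) * N₀⁻¹ := fun k => by
    rw [← hγ k, show (((γ k : Matrix ι ι ℤ) * N (φ 0)).map (Int.cast : ℤ → ℝ)) =
      (γ k : Matrix ι ι ℤ).map (Int.cast : ℤ → ℝ) * N₀ from
        Matrix.map_mul (f := Int.castRingHom ℝ), ← Matrix.mul_assoc, Matrix.mul_assoc _ _ N₀⁻¹,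
      Matrix.mul_nonsing_inv _ hu, Matrix.mul_one]
  simp only [Function.comp_apply, heq]
  exact Tendsto.mul_const (M := Matrix ι ι ℝ) N₀⁻¹ hx

theorem dense_range_quotient_iff {G S : Type*} [Group G] [TopologicalSpace G]
    [IsTopologicalGroup G] (H : Subgroup G) (f : S → G) :
    Dense (Set.range fun s => (f s : G ⧸ H)) ↔
      ∀ O : Set G, IsOpen O → O.Nonempty → ∃ s, ∃ γ ∈ H, f s * γ ∈ O := by
  rw [dense_iff_inter_open]
  constructor
  · intro h O hO hne
    obtain ⟨-, ⟨o, ho, hos⟩, s, rfl⟩ := h _ (QuotientGroup.isOpenMap_coe O hO) (hne.image _)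
    refine ⟨s, (f s)⁻¹ * o, QuotientGroup.eq.1 hos.symm, ?_⟩
    rwa [mul_inv_cancel_left]
  · rintro h U hU ⟨x, hx⟩
    obtain ⟨g, rfl⟩ := QuotientGroup.mk_surjective x
    obtain ⟨s, γ, hγ, hs⟩ := h _ (hU.preimage QuotientGroup.continuous_mk) ⟨g, hx⟩
    refine ⟨_, ?_, s, rfl⟩
    rwa [Set.mem_preimage, QuotientGroup.mk_mul_of_mem _ hγ] at hs

section

variable {m n : ℕ}

theorem SLtop_isInducing_coe : IsInducing fun g : SpecialLinearGroup (Fin m ⊕ Fin n) ℝ =>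
    (g : Matrix (Fin m ⊕ Fin n) (Fin m ⊕ Fin n) ℝ) := ⟨rfl⟩

theorem SL_ext_coe {g h : SpecialLinearGroup (Fin m ⊕ Fin n) ℝ}
    (hgh : (g : Matrix (Fin m ⊕ Fin n) (Fin m ⊕ Fin n) ℝ) = h) : g = h :=
  Subtype.ext hgh

theorem SL_coe_mul (g h : SpecialLinearGroup (Fin m ⊕ Fin n) ℝ) :
    (g * h : SpecialLinearGroup (Fin m ⊕ Fin n) ℝ).1 = g.1 * h.1 := rfl

theorem SL_coe_one : (1 : SpecialLinearGroup (Fin m ⊕ Fin n) ℝ).1 = 1 := rfl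

instance SLtop_isTopologicalGroup :
    IsTopologicalGroup (SpecialLinearGroup (Fin m ⊕ Fin n) ℝ) :=
  SpecialLinearGroup.topologicalGroup

instance SLtop_secondCountable :
    SecondCountableTopology (SpecialLinearGroup (Fin m ⊕ Fin n) ℝ) :=
  haveI : SecondCountableTopology (Matrix (Fin m ⊕ Fin n) (Fin m ⊕ Fin n) ℝ) :=
    inferInstanceAs (SecondCountableTopology (Fin m ⊕ Fin n → Fin m ⊕ Fin n → ℝ))
  SLtop_isInducing_coe.secondCountableTopology

instance SLmeas_borelSpace : BorelSpace (SpecialLinearGroup (Fin m ⊕ Fin n) ℝ) := ⟨rfl⟩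

/-- The basic neighbourhoods of the identity cut out by entrywise bounds. -/
theorem SLtop_hasBasis_nhds_one :
    (𝓝 (1 : SpecialLinearGroup (Fin m ⊕ Fin n) ℝ)).HasBasis (fun η : ℝ => 0 < η) fun η =>
      {g | ∀ i j, |g.1 i j - (1 : Matrix (Fin m ⊕ Fin n) (Fin m ⊕ Fin n) ℝ) i j| < η} := by
  have hb := (Metric.nhds_basis_ball
    (x := (fun i j => (1 : Matrix (Fin m ⊕ Fin n) (Fin m ⊕ Fin n) ℝ) i j))).comap
    (fun (g : SpecialLinearGroup (Fin m ⊕ Fin n) ℝ) i j =>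
      (g : Matrix (Fin m ⊕ Fin n) (Fin m ⊕ Fin n) ℝ) i j)
  rw [SLtop_isInducing_coe.nhds_eq_comap]
  refine hb.to_hasBasis (fun η hη => ⟨η, hη, fun g hg => ?_⟩) (fun η hη => ⟨η, hη, fun g hg => ?_⟩)
  · rw [Set.mem_preimage, Metric.mem_ball, dist_pi_lt_iff hη]
    exact fun i => (dist_pi_lt_iff hη).2 fun j => hg i j
  · rw [Set.mem_preimage, Metric.mem_ball, dist_pi_lt_iff hη] at hg
    exact fun i j => (dist_pi_lt_iff hη).1 (hg i) j

variable {a : ℝ → SpecialLinearGroup (Fin m ⊕ Fin n) ℝ}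
    {u : (Fin m → Fin n → ℝ) → SpecialLinearGroup (Fin m ⊕ Fin n) ℝ}

theorem diagonal_flow_add
    (ha : ∀ s : ℝ, (a s : Matrix (Fin m ⊕ Fin n) (Fin m ⊕ Fin n) ℝ) =
      fromBlocks (Real.exp (s / m) • (1 : Matrix (Fin m) (Fin m) ℝ)) 0 0
        (Real.exp (-s / n) • (1 : Matrix (Fin n) (Fin n) ℝ))) (s t : ℝ) :
    a (s + t) = a s * a t := by
  apply SL_ext_coe
  rw [SL_coe_mul, ha, ha, ha, fromBlocks_multiply]
  simp [smul_smul, ← Real.exp_add, add_div, add_comm]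

theorem diagonal_flow_zero
    (ha : ∀ s : ℝ, (a s : Matrix (Fin m ⊕ Fin n) (Fin m ⊕ Fin n) ℝ) =
      fromBlocks (Real.exp (s / m) • (1 : Matrix (Fin m) (Fin m) ℝ)) 0 0
        (Real.exp (-s / n) • (1 : Matrix (Fin n) (Fin n) ℝ))) :
    a 0 = 1 := by
  apply SL_ext_coe
  simp [ha]

theorem horospherical_add
    (hu : ∀ A, (u A : Matrix (Fin m ⊕ Fin n) (Fin m ⊕ Fin n) ℝ) = fromBlocks 1 (of A) 0 1)
    (A B : Fin m → Fin n → ℝ) : u (A + B) = u A * u B := by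
  apply SL_ext_coe
  rw [SL_coe_mul, hu, hu, hu, fromBlocks_multiply]
  simp [add_comm]

theorem horospherical_zero
    (hu : ∀ A, (u A : Matrix (Fin m ⊕ Fin n) (Fin m ⊕ Fin n) ℝ) = fromBlocks 1 (of A) 0 1) :
    u 0 = 1 := by
  apply SL_ext_coe
  simp [hu]

theorem horospherical_continuous
    (hu : ∀ A, (u A : Matrix (Fin m ⊕ Fin n) (Fin m ⊕ Fin n) ℝ) = fromBlocks 1 (of A) 0 1) :
    Continuous u := by
  rw [SLtop_isInducing_coe.continuous_iff]
  simp only [Function.comp_def, hu]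
  exact Continuous.matrix_fromBlocks continuous_const continuous_id continuous_const
    continuous_const

theorem diagonal_mul_horospherical
    (ha : ∀ s : ℝ, (a s : Matrix (Fin m ⊕ Fin n) (Fin m ⊕ Fin n) ℝ) =
      fromBlocks (Real.exp (s / m) • (1 : Matrix (Fin m) (Fin m) ℝ)) 0 0
        (Real.exp (-s / n) • (1 : Matrix (Fin n) (Fin n) ℝ)))
    (hu : ∀ A, (u A : Matrix (Fin m ⊕ Fin n) (Fin m ⊕ Fin n) ℝ) = fromBlocks 1 (of A) 0 1)
    (s : ℝ) (A : Fin m → Fin n → ℝ) :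
    a s * u (Real.exp (-(s / m + s / n)) • A) = u A * a s := by
  apply SL_ext_coe
  rw [SL_coe_mul, SL_coe_mul, ha, hu, hu, fromBlocks_multiply,
    fromBlocks_multiply]
  have : Real.exp (s / m) * Real.exp (-(s / m + s / n)) = Real.exp (-s / n) := by
    rw [← Real.exp_add]; congr 1; ring
  generalize Real.exp (-(s / m + s / n)) = c at this ⊢
  simp [smul_smul, this]

/-- Conjugating a block lower triangular matrix by `a s`, `s ≥ 0`, moves no entry away from the
identity matrix. -/
theorem abs_diagonal_conj_sub_one_le
    (ha : ∀ s : ℝ, (a s : Matrix (Fin m ⊕ Fin n) (Fin m ⊕ Fin n) ℝ) =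
      fromBlocks (Real.exp (s / m) • (1 : Matrix (Fin m) (Fin m) ℝ)) 0 0
        (Real.exp (-s / n) • (1 : Matrix (Fin n) (Fin n) ℝ)))
    {q : SpecialLinearGroup (Fin m ⊕ Fin n) ℝ}
    (hq : q.1.toBlocks₁₂ = 0) {s : ℝ} (hs : 0 ≤ s) (i j : Fin m ⊕ Fin n) :
    |(a s * q * a (-s) : SpecialLinearGroup (Fin m ⊕ Fin n) ℝ).1 i j -
      (1 : Matrix (Fin m ⊕ Fin n) (Fin m ⊕ Fin n) ℝ) i j| ≤
    |q.1 i j - (1 : Matrix (Fin m ⊕ Fin n) (Fin m ⊕ Fin n) ℝ) i j| := by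
  have h1 : Real.exp (s / m) * Real.exp (-s / m) = 1 := by
    rw [← Real.exp_add]; simp [neg_div]
  have h2 : Real.exp (s / n) * Real.exp (-s / n) = 1 := by
    rw [← Real.exp_add]; simp [neg_div]
  have hc : (a s * q * a (-s) : SpecialLinearGroup (Fin m ⊕ Fin n) ℝ).1 =
      fromBlocks (q : Matrix (Fin m ⊕ Fin n) (Fin m ⊕ Fin n) ℝ).toBlocks₁₁ 0
        ((Real.exp (-s / n) * Real.exp (-s / m)) • q.1.toBlocks₂₁)
        (q : Matrix (Fin m ⊕ Fin n) (Fin m ⊕ Fin n) ℝ).toBlocks₂₂ := by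
    rw [SL_coe_mul, SL_coe_mul, ha, ha,
      ← fromBlocks_toBlocks q.1, hq, fromBlocks_multiply, fromBlocks_multiply]
    simp [smul_smul, h1, h2, mul_comm]
  have hle : |Real.exp (-s / n) * Real.exp (-s / m)| ≤ 1 := by
    rw [← Real.exp_add, Real.abs_exp, Real.exp_le_one_iff, neg_div, neg_div]
    have : 0 ≤ s / n := by positivity
    have : 0 ≤ s / m := by positivity
    linarith
  rw [hc]
  rcases i with i | i <;> rcases j with j | j
  · simp [toBlocks₁₁, ← fromBlocks_one]
  · simp
  · simp only [fromBlocks_apply₂₁, ← fromBlocks_one, Matrix.zero_apply, sub_zero,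
      Matrix.smul_apply, smul_eq_mul, abs_mul _ (toBlocks₂₁ _ i j)]
    exact mul_le_of_le_one_left (abs_nonneg _) hle
  · simp [toBlocks₂₂, ← fromBlocks_one]

theorem continuousAt_matrix_mul {X α β γ : Type*} [TopologicalSpace X] [Fintype β]
    {f : X → Matrix α β ℝ} {g : X → Matrix β γ ℝ} {x : X} (hf : ContinuousAt f x)
    (hg : ContinuousAt g x) : ContinuousAt (fun y => f y * g y) x := by
  have hmul : Continuous fun p : Matrix α β ℝ × Matrix β γ ℝ => p.1 * p.2 :=
    continuous_fst.matrix_mul continuous_snd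
  exact hmul.continuousAt.comp (f := fun y => (f y, g y)) (hf.prodMk hg)

/-- Every element close to the identity is a small block lower triangular matrix times an element
of the expanding horospherical group. -/
theorem eventually_exists_lower_mul_horospherical
    (hu : ∀ A, (u A : Matrix (Fin m ⊕ Fin n) (Fin m ⊕ Fin n) ℝ) = fromBlocks 1 (of A) 0 1)
    {W : Set (SpecialLinearGroup (Fin m ⊕ Fin n) ℝ)} (hW : W ∈ 𝓝 1) :
    ∀ᶠ h in 𝓝 (1 : SpecialLinearGroup (Fin m ⊕ Fin n) ℝ), ∃ q ∈ W, ∃ A,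
      (q : Matrix (Fin m ⊕ Fin n) (Fin m ⊕ Fin n) ℝ).toBlocks₁₂ = 0 ∧ h = q * u A := by
  let inv₁₁ : SpecialLinearGroup (Fin m ⊕ Fin n) ℝ → Matrix (Fin m) (Fin m) ℝ :=
    fun h => (h.1.toBlocks₁₁.det)⁻¹ • h.1.toBlocks₁₁.adjugate
  let B : SpecialLinearGroup (Fin m ⊕ Fin n) ℝ → Fin m → Fin n → ℝ :=
    fun h => inv₁₁ h * (h : Matrix (Fin m ⊕ Fin n) (Fin m ⊕ Fin n) ℝ).toBlocks₁₂
  have hval : Continuous fun g : SpecialLinearGroup (Fin m ⊕ Fin n) ℝ =>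
      (g : Matrix (Fin m ⊕ Fin n) (Fin m ⊕ Fin n) ℝ) :=
    SLtop_isInducing_coe.continuous
  have h11 : Continuous fun h : SpecialLinearGroup (Fin m ⊕ Fin n) ℝ =>
      (h : Matrix (Fin m ⊕ Fin n) (Fin m ⊕ Fin n) ℝ).toBlocks₁₁ := hval.matrix_submatrix _ _
  have h12 : Continuous fun h : SpecialLinearGroup (Fin m ⊕ Fin n) ℝ =>
      (h : Matrix (Fin m ⊕ Fin n) (Fin m ⊕ Fin n) ℝ).toBlocks₁₂ := hval.matrix_submatrix _ _
  have hone : (1 : SpecialLinearGroup (Fin m ⊕ Fin n) ℝ).1.toBlocks₁₁ = 1 := by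
    rw [SL_coe_one, ← fromBlocks_one, toBlocks_fromBlocks₁₁]
  have hone' : (1 : SpecialLinearGroup (Fin m ⊕ Fin n) ℝ).1.toBlocks₁₂ = 0 := by
    rw [SL_coe_one, ← fromBlocks_one, toBlocks_fromBlocks₁₂]
  have hdet : (1 : SpecialLinearGroup (Fin m ⊕ Fin n) ℝ).1.toBlocks₁₁.det ≠ 0 := by
    rw [hone, det_one]; exact one_ne_zero
  have hinv : ContinuousAt inv₁₁ 1 :=
    (h11.matrix_det.continuousAt.inv₀ hdet).smul h11.matrix_adjugate.continuousAt
  have hB : ContinuousAt B 1 := continuousAt_matrix_mul hinv h12.continuousAt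
  have hB1 : B 1 = 0 := by
    simp only [B, hone', Matrix.mul_zero]
    rfl
  have hq : ContinuousAt (fun h => h * u (-B h)) 1 :=
    continuousAt_id.mul ((horospherical_continuous hu).continuousAt.comp hB.neg)
  have hq1 : (1 : SpecialLinearGroup (Fin m ⊕ Fin n) ℝ) * u (-B 1) = 1 := by
    rw [hB1, neg_zero, horospherical_zero hu, mul_one]
  have hW' : ∀ᶠ h in 𝓝 (1 : SpecialLinearGroup (Fin m ⊕ Fin n) ℝ), h * u (-B h) ∈ W := by
    apply hq.eventually_mem
    rwa [hq1]
  filter_upwards [hW', h11.matrix_det.continuousAt.eventually_ne hdet] with h hhW hhdet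
  refine ⟨_, hhW, B h, ?_, ?_⟩
  · have hmul : (h : Matrix (Fin m ⊕ Fin n) (Fin m ⊕ Fin n) ℝ).toBlocks₁₁ * inv₁₁ h = 1 := by
      simp only [inv₁₁, Matrix.mul_smul, mul_adjugate, smul_smul, inv_mul_cancel₀ hhdet, one_smul]
    rw [SL_coe_mul, hu, ← fromBlocks_toBlocks (h : Matrix (Fin m ⊕ Fin n) (Fin m ⊕ Fin n) ℝ),
      fromBlocks_multiply, toBlocks_fromBlocks₁₂]
    have : of (-B h) = -(inv₁₁ h * (h : Matrix (Fin m ⊕ Fin n) (Fin m ⊕ Fin n) ℝ).toBlocks₁₂) := rfl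
    rw [this, Matrix.mul_neg, ← Matrix.mul_assoc, hmul, Matrix.one_mul, Matrix.mul_one,
      neg_add_cancel]
  · rw [mul_assoc, ← horospherical_add hu, neg_add_cancel, horospherical_zero hu, mul_one]

end

section

variable {m n : ℕ} {a : ℝ → SpecialLinearGroup (Fin m ⊕ Fin n) ℝ}
    {u : (Fin m → Fin n → ℝ) → SpecialLinearGroup (Fin m ⊕ Fin n) ℝ}

/-- If `A` is badly approximated at scale `k`, the lattice `a k * u A * ℤ ^ (m + n)` has no short
vectors. -/
theorem le_norm_diagonal_mul_horospherical_mulVec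
    (ha : ∀ s : ℝ, (a s : Matrix (Fin m ⊕ Fin n) (Fin m ⊕ Fin n) ℝ) =
      fromBlocks (Real.exp (s / m) • (1 : Matrix (Fin m) (Fin m) ℝ)) 0 0
        (Real.exp (-s / n) • (1 : Matrix (Fin n) (Fin n) ℝ)))
    (hu : ∀ A, (u A : Matrix (Fin m ⊕ Fin n) (Fin m ⊕ Fin n) ℝ) = fromBlocks 1 (of A) 0 1)
    {A : Fin m → Fin n → ℝ} {ε : ℝ} (hε : ε ≤ 1) {s : ℝ} (hs : 0 ≤ s)
    (hA : (fun i j => (A i j : UnitAddCircle)) ∉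
      approximableSet m n (ε * Real.exp (s / n)) (ε * Real.exp (-(s / m))))
    {z : Fin m ⊕ Fin n → ℤ} (hz : z ≠ 0) :
    ε ≤ ‖(a s * u A : SpecialLinearGroup (Fin m ⊕ Fin n) ℝ).1 *ᵥ fun j => (z j : ℝ)‖ := by
  by_contra! hlt
  set v := (a s * u A : SpecialLinearGroup (Fin m ⊕ Fin n) ℝ).1 *ᵥ fun j => (z j : ℝ) with hv
  have hcoe : (a s * u A : SpecialLinearGroup (Fin m ⊕ Fin n) ℝ).1 =
      fromBlocks (Real.exp (s / m) • (1 : Matrix (Fin m) (Fin m) ℝ))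
        (Real.exp (s / m) • of A) 0 (Real.exp (-s / n) • (1 : Matrix (Fin n) (Fin n) ℝ)) := by
    rw [SL_coe_mul, ha, hu, fromBlocks_multiply]
    simp
  rw [hcoe, fromBlocks_mulVec] at hv
  have htop : ∀ i, v (Sum.inl i) =
      Real.exp (s / m) * (z (Sum.inl i) + ∑ j, A i j * z (Sum.inr j)) := by
    intro i
    rw [hv]
    simp [smul_mulVec, mulVec, dotProduct, mul_add, Finset.mul_sum, mul_assoc]
  have hbot : ∀ j, v (Sum.inr j) = Real.exp (-s / n) * z (Sum.inr j) := by
    intro j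
    rw [hv]
    simp [smul_mulVec]
  have htop' : ∀ i, |z (Sum.inl i) + ∑ j, A i j * z (Sum.inr j)| < ε * Real.exp (-(s / m)) := by
    intro i
    have := (norm_le_pi_norm v (Sum.inl i)).trans_lt hlt
    rw [htop, Real.norm_eq_abs, abs_mul, Real.abs_exp] at this
    rwa [Real.exp_neg, ← div_eq_mul_inv, lt_div_iff₀' (Real.exp_pos _)]
  have hbot' : ∀ j, |(z (Sum.inr j) : ℝ)| < ε * Real.exp (s / n) := by
    intro j
    have := (norm_le_pi_norm v (Sum.inr j)).trans_lt hlt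
    rw [hbot, Real.norm_eq_abs, abs_mul, Real.abs_exp, neg_div, Real.exp_neg] at this
    rwa [inv_mul_lt_iff₀' (Real.exp_pos _)] at this
  by_cases hq : (fun j => z (Sum.inr j)) = 0
  · refine hz ?_
    ext (i | j)
    · have h := htop' i
      have hq' : ∀ j, z (Sum.inr j) = 0 := fun j => congrFun hq j
      simp only [hq', Int.cast_zero, mul_zero, Finset.sum_const_zero, add_zero] at h
      have hle : Real.exp (-(s / m)) ≤ 1 := Real.exp_le_one_iff.2 (by simp; positivity)
      have h1 : |(z (Sum.inl i) : ℝ)| < 1 := h.trans_le (mul_le_one₀ hε (Real.exp_pos _).le hle)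
      exact Int.abs_lt_one_iff.1 (by exact_mod_cast h1)
    · exact congrFun hq j
  · refine hA ⟨fun j => z (Sum.inr j), hq, hbot', fun i => lt_of_le_of_lt ?_ (htop' i)⟩
    have : ∑ j, z (Sum.inr j) • (A i j : UnitAddCircle) =
        ((z (Sum.inl i) + ∑ j, A i j * z (Sum.inr j) : ℝ) : UnitAddCircle) := by
      have hzero : ((z (Sum.inl i) : ℝ) : UnitAddCircle) = 0 :=
        (AddCircle.coe_eq_zero_iff 1).2 ⟨z (Sum.inl i), by simp⟩
      rw [AddCircle.coe_add, hzero, zero_add]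
      have := map_sum (QuotientAddGroup.mk' (AddSubgroup.zmultiples (1 : ℝ)))
        (fun j => A i j * z (Sum.inr j)) Finset.univ
      refine Eq.trans ?_ this.symm
      refine Finset.sum_congr rfl fun j _ => ?_
      rw [mul_comm, ← zsmul_eq_mul]
      rfl
    rw [this]
    exact QuotientAddGroup.norm_mk_le_norm

/-- For almost every `A`, the trajectory of `u A` returns infinitely often to a compact set modulo
`Γ`. -/
theorem ae_exists_tendsto_diagonal_mul_horospherical (hm : 0 < m) (hn : 0 < n)
    (ha : ∀ s : ℝ, (a s : Matrix (Fin m ⊕ Fin n) (Fin m ⊕ Fin n) ℝ) =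
      fromBlocks (Real.exp (s / m) • (1 : Matrix (Fin m) (Fin m) ℝ)) 0 0
        (Real.exp (-s / n) • (1 : Matrix (Fin n) (Fin n) ℝ)))
    (hu : ∀ A, (u A : Matrix (Fin m ⊕ Fin n) (Fin m ⊕ Fin n) ℝ) = fromBlocks 1 (of A) 0 1) :
    ∀ᵐ A : Fin m → Fin n → ℝ, ∃ φ : ℕ → ℕ, StrictMono φ ∧ ∃ γ : ℕ → Γ m n, ∃ x,
      Tendsto (fun k => a (φ k) * u A * γ k) atTop (𝓝 x) := by
  have : Nonempty (Fin m ⊕ Fin n) := ⟨Sum.inl ⟨0, hm⟩⟩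
  filter_upwards [ae_matrix_of_ae_torus
    (ae_torus_exists_frequently_notMem_approximableSet hm hn)] with A hA
  obtain ⟨ε, hε, hε1, hfreq⟩ := hA
  obtain ⟨ψ, hψ, hψA⟩ := extraction_of_frequently_atTop hfreq
  obtain ⟨φ, hφ, γ, x, hx⟩ := exists_subseq_tendsto_mul_specialLinearGroup_int hε
    (fun k => (a (ψ k) * u A : SpecialLinearGroup (Fin m ⊕ Fin n) ℝ).1) (fun k => (a (ψ k) * u A).2)
    fun k z hz => le_norm_diagonal_mul_horospherical_mulVec ha hu hε1 (Nat.cast_nonneg _)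
      (hψA k) hz
  let γ' : ℕ → Γ m n := fun k => ⟨SpecialLinearGroup.map (Int.castRingHom ℝ) (γ k), γ k, rfl⟩
  have hlim : Tendsto (fun k => (a (ψ (φ k)) * u A * γ' k :
      SpecialLinearGroup (Fin m ⊕ Fin n) ℝ).1) atTop (𝓝 x) := hx
  have hdet : x.det = 1 := by
    refine tendsto_nhds_unique
      (((continuous_id.matrix_det (R := ℝ)).tendsto x).comp hlim) ?_
    refine tendsto_const_nhds.congr fun k => ?_
    exact (Subtype.prop (a (ψ (φ k)) * u A * γ' k :
      SpecialLinearGroup (Fin m ⊕ Fin n) ℝ)).symm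
  exact ⟨ψ ∘ φ, hψ.comp hφ, γ', ⟨x, hdet⟩, SLtop_isInducing_coe.tendsto_nhds_iff.2 hlim⟩

/-- The points whose forward trajectory under `a`, modulo `H`, avoids `O`. -/
def avoidingSet {G : Type*} [Group G] (a : ℝ → G) (H : Subgroup G) (O : Set G) : Set G :=
  {g | ∀ s > 0, ∀ γ ∈ H, a s * g * γ ∉ O}

theorem isClosed_avoidingSet {G : Type*} [Group G] [TopologicalSpace G] [IsTopologicalGroup G]
    (a : ℝ → G) (H : Subgroup G) {O : Set G} (hO : IsOpen O) : IsClosed (avoidingSet a H O) := by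
  simp only [avoidingSet, Set.ofPred_forall]
  refine isClosed_iInter fun s => isClosed_iInter fun _ => isClosed_iInter fun γ =>
    isClosed_iInter fun _ => ?_
  exact hO.isClosed_compl.preimage (f := fun g => a s * g * γ) (by fun_prop)

theorem mul_mem_avoidingSet_iff {G : Type*} [Group G] {a : ℝ → G} {H : Subgroup G} {O : Set G}
    {g γ : G} (hγ : γ ∈ H) : g * γ ∈ avoidingSet a H O ↔ g ∈ avoidingSet a H O := by
  constructor
  · intro h s hs γ' hγ'
    have := h s hs (γ⁻¹ * γ') (H.mul_mem (H.inv_mem hγ) hγ')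
    simpa [mul_assoc] using this
  · intro h s hs γ' hγ'
    have := h s hs (γ * γ') (H.mul_mem hγ hγ')
    simpa [mul_assoc] using this

theorem flow_mul_mem_avoidingSet {G : Type*} [Group G] {a : ℝ → G}
    (ha : ∀ s t, a (s + t) = a s * a t) {H : Subgroup G} {O : Set G} {g : G}
    (hg : g ∈ avoidingSet a H O) {t : ℝ} (ht : 0 ≤ t) : a t * g ∈ avoidingSet a H O := by
  intro s hs γ hγ
  have := hg (s + t) (by linarith) γ hγ
  rwa [ha, mul_assoc (a s)] at this

/-- If `A` is a density point of the set of parameters whose trajectories avoid `O`, and the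
trajectory of `u A` accumulates at `x` modulo `Γ`, then the whole expanding horospherical orbit of
`x` consists of points whose trajectories avoid `O`. -/
theorem horospherical_mul_mem_avoidingSet (hm : 0 < m)
    (ha : ∀ s : ℝ, (a s : Matrix (Fin m ⊕ Fin n) (Fin m ⊕ Fin n) ℝ) =
      fromBlocks (Real.exp (s / m) • (1 : Matrix (Fin m) (Fin m) ℝ)) 0 0
        (Real.exp (-s / n) • (1 : Matrix (Fin n) (Fin n) ℝ)))
    (hu : ∀ A, (u A : Matrix (Fin m ⊕ Fin n) (Fin m ⊕ Fin n) ℝ) = fromBlocks 1 (of A) 0 1)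
    {O : Set (SpecialLinearGroup (Fin m ⊕ Fin n) ℝ)} (hO : IsOpen O)
    {A : Fin m → Fin n → ℝ}
    (hA : ∀ (K : ℕ) (w : ℕ → Fin m → Fin n → ℝ) (δ : ℕ → ℝ), Tendsto δ atTop (𝓝[>] 0) →
      (∀ᶠ j in atTop, A ∈ Metric.closedBall (w j) (K * δ j)) →
      Tendsto (fun j => volume ({B | u B ∈ avoidingSet a (Γ m n) O} ∩
        Metric.closedBall (w j) (δ j)) / volume (Metric.closedBall (w j) (δ j))) atTop (𝓝 1))
    {φ : ℕ → ℕ} (hφ : StrictMono φ) {γ : ℕ → Γ m n}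
    {x : SpecialLinearGroup (Fin m ⊕ Fin n) ℝ}
    (hx : Tendsto (fun k => a (φ k) * u A * γ k) atTop (𝓝 x)) (A' : Fin m → Fin n → ℝ) :
    u A' * x ∈ avoidingSet a (Γ m n) O := by
  by_contra hcon
  have hcont : Continuous fun p : (Fin m → Fin n → ℝ) × SpecialLinearGroup (Fin m ⊕ Fin n) ℝ =>
      u p.1 * p.2 := ((horospherical_continuous hu).comp continuous_fst).mul continuous_snd
  have hnhds : ∀ᶠ p in 𝓝 A' ×ˢ 𝓝 x, u p.1 * p.2 ∈ (avoidingSet a (Γ m n) O)ᶜ := by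
    rw [← nhds_prod_eq]
    exact hcont.continuousAt.eventually_mem
      ((isClosed_avoidingSet a _ hO).isOpen_compl.mem_nhds hcon)
  obtain ⟨P, hP, Q, hQ, hPQ⟩ := eventually_prod_iff.1 hnhds
  obtain ⟨ρ, hρ, hball⟩ := Metric.nhds_basis_closedBall.eventually_iff.1 hP
  let c : ℕ → ℝ := fun k => Real.exp (-((φ k : ℝ) / m + φ k / n))
  have hc0 : ∀ k, 0 < c k := fun k => Real.exp_pos _
  have hc : Tendsto c atTop (𝓝 0) := by
    refine Real.tendsto_exp_neg_atTop_nhds_zero.comp ?_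
    refine tendsto_atTop_mono (fun k => le_add_of_nonneg_right (by positivity)) ?_
    exact (tendsto_natCast_atTop_atTop.comp hφ.tendsto_atTop).atTop_div_const
      (by exact_mod_cast hm)
  have hdisj : ∀ᶠ k in atTop, {B | u B ∈ avoidingSet a (Γ m n) O} ∩
      Metric.closedBall (A + c k • A') (c k * ρ) = ∅ := by
    filter_upwards [hx.eventually hQ] with k hk
    rw [Set.eq_empty_iff_forall_notMem]
    rintro B ⟨hB, hBball⟩
    have hA'' : (c k)⁻¹ • (B - A) ∈ Metric.closedBall A' ρ := by
      rw [Metric.mem_closedBall, dist_eq_norm] at hBball ⊢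
      have : (c k)⁻¹ • (B - A) - A' = (c k)⁻¹ • (B - (A + c k • A')) := by
        rw [← sub_sub, smul_sub _ (B - A), inv_smul_smul₀ (hc0 k).ne']
      rw [this, norm_smul, norm_inv, Real.norm_of_nonneg (hc0 k).le,
        inv_mul_le_iff₀ (hc0 k)]
      exact hBball
    refine hPQ (hball hA'') hk ?_
    have hBA : c k • ((c k)⁻¹ • (B - A)) + A = B := by
      rw [smul_inv_smul₀ (hc0 k).ne', sub_add_cancel]
    rw [← mul_assoc, mul_mem_avoidingSet_iff (γ k).2, ← mul_assoc,
      ← diagonal_mul_horospherical ha hu, mul_assoc, ← horospherical_add hu]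
    refine flow_mul_mem_avoidingSet (diagonal_flow_add ha) ?_ (Nat.cast_nonneg _)
    change u (c k • ((c k)⁻¹ • (B - A)) + A) ∈ _
    rwa [hBA]
  obtain ⟨K, hK⟩ := exists_nat_ge (‖A'‖ / ρ)
  have hlim := hA K (fun k => A + c k • A') (fun k => c k * ρ) ?_ ?_
  · have h0 : Tendsto (fun _ : ℕ => (0 : ENNReal)) atTop (𝓝 1) := by
      refine hlim.congr' ?_
      filter_upwards [hdisj] with k hk
      rw [hk, measure_empty, ENNReal.zero_div]
    exact zero_ne_one (tendsto_nhds_unique tendsto_const_nhds h0)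
  · refine tendsto_nhdsWithin_iff.2 ⟨?_, .of_forall fun k => mul_pos (hc0 k) hρ⟩
    simpa using hc.mul_const ρ
  · refine .of_forall fun k => ?_
    rw [Metric.mem_closedBall, dist_eq_norm, sub_add_cancel_left, norm_neg, norm_smul,
      Real.norm_of_nonneg (hc0 k).le]
    rw [div_le_iff₀ hρ] at hK
    nlinarith [hc0 k]

/-- If every point of the trajectory of `g₀` at integer times has a dense forward trajectory, then
no horospherical orbit consists only of points whose trajectories avoid `O`. -/
theorem exists_horospherical_mul_notMem_avoidingSet
    (ha : ∀ s : ℝ, (a s : Matrix (Fin m ⊕ Fin n) (Fin m ⊕ Fin n) ℝ) =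
      fromBlocks (Real.exp (s / m) • (1 : Matrix (Fin m) (Fin m) ℝ)) 0 0
        (Real.exp (-s / n) • (1 : Matrix (Fin n) (Fin n) ℝ)))
    (hu : ∀ A, (u A : Matrix (Fin m ⊕ Fin n) (Fin m ⊕ Fin n) ℝ) = fromBlocks 1 (of A) 0 1)
    {g₀ : SpecialLinearGroup (Fin m ⊕ Fin n) ℝ}
    (hg₀ : ∀ (k : ℕ) (O : Set (SpecialLinearGroup (Fin m ⊕ Fin n) ℝ)), IsOpen O → O.Nonempty →
      ∃ s > 0, ∃ γ ∈ Γ m n, a s * (a k * g₀) * γ ∈ O)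
    {O : Set (SpecialLinearGroup (Fin m ⊕ Fin n) ℝ)} (hO : IsOpen O) (hne : O.Nonempty)
    (x : SpecialLinearGroup (Fin m ⊕ Fin n) ℝ) :
    ∃ A, u A * x ∉ avoidingSet a (Γ m n) O := by
  obtain ⟨o, ho⟩ := hne
  have hcont : Continuous fun p : SpecialLinearGroup (Fin m ⊕ Fin n) ℝ ×
      SpecialLinearGroup (Fin m ⊕ Fin n) ℝ => p.1⁻¹ * p.2 := by fun_prop
  have hnhds : ∀ᶠ p in 𝓝 1 ×ˢ 𝓝 o, p.1⁻¹ * p.2 ∈ O := by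
    rw [← nhds_prod_eq]
    exact hcont.continuousAt.eventually_mem (hO.mem_nhds (by simpa using ho))
  obtain ⟨P, hP, Q, hQ, hPQ⟩ := eventually_prod_iff.1 hnhds
  obtain ⟨η, hη, hηP⟩ := SLtop_hasBasis_nhds_one.eventually_iff.1 hP
  obtain ⟨O', hO'Q, hO', hoO'⟩ := eventually_nhds_iff.1 hQ
  obtain ⟨V, hVsub, hV, hV1⟩ := eventually_nhds_iff.1
    (eventually_exists_lower_mul_horospherical hu (SLtop_hasBasis_nhds_one.mem_of_mem hη))
  obtain ⟨t, ht, γ₁, hγ₁, hy⟩ := hg₀ 0 ((fun y => y * x⁻¹) ⁻¹' V)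
    (hV.preimage (by fun_prop)) ⟨x, by simpa using hV1⟩
  rw [Nat.cast_zero, diagonal_flow_zero ha, one_mul] at hy
  obtain ⟨q, hq, A, hq12, hqA⟩ := hVsub _ hy
  obtain ⟨k, hk⟩ := exists_nat_ge t
  obtain ⟨s', hs', γ₂, hγ₂, hz⟩ := hg₀ k O' hO' ⟨o, hoO'⟩
  refine ⟨A, fun hmem => ?_⟩
  have hs : 0 < s' + k - t := by linarith
  refine hmem (s' + k - t) hs (γ₁⁻¹ * γ₂) ((Γ m n).mul_mem ((Γ m n).inv_mem hγ₁) hγ₂) ?_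
  have hconj : P (a (s' + k - t) * q * a (-(s' + k - t))) :=
    hηP fun i j => (abs_diagonal_conj_sub_one_le ha hq12 hs.le i j).trans_lt (hq i j)
  have hmain := hPQ hconj (hO'Q _ hz)
  have hneg : a (-(s' + k - t)) = (a (s' + k - t))⁻¹ := by
    rw [eq_inv_iff_mul_eq_one, ← diagonal_flow_add ha, neg_add_cancel, diagonal_flow_zero ha]
  have hflow : a s' * (a k * g₀) = a (s' + k - t) * (a t * g₀) := by
    rw [← mul_assoc, ← mul_assoc, ← diagonal_flow_add ha, ← diagonal_flow_add ha, sub_add_cancel]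
  have hux : u A * x = q⁻¹ * (a t * g₀ * γ₁) := by
    rw [eq_inv_mul_iff_mul_eq, ← mul_assoc, ← hqA, inv_mul_cancel_right]
  convert hmain using 1
  rw [hux, hneg, hflow]
  group

/-- A property that holds almost everywhere for a left invariant measure holds, at almost every
point, for countably many prescribed left translates simultaneously. -/
theorem ae_forall_nat_mul_left {μ : Measure (SpecialLinearGroup (Fin m ⊕ Fin n) ℝ)}
    (hinv : ∀ g, μ.map (fun x => g * x) = μ)
    {p : SpecialLinearGroup (Fin m ⊕ Fin n) ℝ → Prop} (hp : ∀ᵐ g ∂μ, p g)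
    (b : ℕ → SpecialLinearGroup (Fin m ⊕ Fin n) ℝ) : ∀ᵐ g ∂μ, ∀ k, p (b k * g) := by
  rw [ae_all_iff]
  intro k
  have hmp : MeasurePreserving (fun x => b k * x) μ μ :=
    ⟨(continuous_const_mul (b k)).measurable, hinv _⟩
  exact hmp.quasiMeasurePreserving.ae hp

end

/-- For Lebesgue-a.e. `m × n` matrix `A`, the forward trajectory of the lattice `u_A ℤ^{m+n}`
under the diagonal flow `a_s = diag(e^{s/m} Iₘ, e^{-s/n} Iₙ)` is dense in the space of
unimodular lattices `SL_{m+n}(ℝ)/SL_{m+n}(ℤ)`.  Ergodicity of the flow (Moore's theorem)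
is taken as the hypothesis `hErg`, stated for a.e. point with respect to a (nonzero,
left-invariant) Haar measure `μ` on `SL_{m+n}(ℝ)`. -/
theorem dense_diagonal_orbit_ae (m n : ℕ) (hm : 0 < m) (hn : 0 < n)
    (a : ℝ → Matrix.SpecialLinearGroup (Fin m ⊕ Fin n) ℝ)
    (ha : ∀ s : ℝ, (a s : Matrix (Fin m ⊕ Fin n) (Fin m ⊕ Fin n) ℝ) =
      Matrix.fromBlocks (Real.exp (s / m) • (1 : Matrix (Fin m) (Fin m) ℝ)) 0 0
        (Real.exp (-s / n) • (1 : Matrix (Fin n) (Fin n) ℝ)))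
    (u : (Fin m → Fin n → ℝ) → Matrix.SpecialLinearGroup (Fin m ⊕ Fin n) ℝ)
    (hu : ∀ A, (u A : Matrix (Fin m ⊕ Fin n) (Fin m ⊕ Fin n) ℝ) =
      Matrix.fromBlocks 1 (Matrix.of A) 0 1)
    (μ : Measure (Matrix.SpecialLinearGroup (Fin m ⊕ Fin n) ℝ))
    (hμ : μ ≠ 0)
    (hinv : ∀ g, μ.map (fun x => g * x) = μ)
    (hErg : ∀ᵐ g ∂μ, Dense (Set.range fun s : Set.Ioi (0 : ℝ) =>
      ((a s * g : Matrix.SpecialLinearGroup (Fin m ⊕ Fin n) ℝ) :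
        Matrix.SpecialLinearGroup (Fin m ⊕ Fin n) ℝ ⧸ Γ m n))) :
    ∀ᵐ A ∂(volume : Measure (Fin m → Fin n → ℝ)),
      Dense (Set.range fun s : Set.Ioi (0 : ℝ) =>
        ((a s * u A : Matrix.SpecialLinearGroup (Fin m ⊕ Fin n) ℝ) :
          Matrix.SpecialLinearGroup (Fin m ⊕ Fin n) ℝ ⧸ Γ m n)) := by
  have : NeZero μ := ⟨hμ⟩
  obtain ⟨g₀, hg₀⟩ := (ae_forall_nat_mul_left hinv hErg fun k => a k).exists
  have hg₀' : ∀ (k : ℕ) (O : Set (SpecialLinearGroup (Fin m ⊕ Fin n) ℝ)), IsOpen O →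
      O.Nonempty → ∃ s > 0, ∃ γ ∈ Γ m n, a s * (a k * g₀) * γ ∈ O := by
    intro k O hO hne
    obtain ⟨s, γ, hγ, hs⟩ := (dense_range_quotient_iff (Γ m n)
      fun s : Set.Ioi (0 : ℝ) => a s * (a k * g₀)).1 (hg₀ k) O hO hne
    exact ⟨s, s.2, γ, hγ, hs⟩
  have hnull : ∀ O : Set (SpecialLinearGroup (Fin m ⊕ Fin n) ℝ), IsOpen O → O.Nonempty →
      ∀ᵐ A : Fin m → Fin n → ℝ, u A ∉ avoidingSet a (Γ m n) O := by
    intro O hO hne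
    have hclosed : IsClosed {A | u A ∈ avoidingSet a (Γ m n) O} :=
      (isClosed_avoidingSet a _ hO).preimage (horospherical_continuous hu)
    have hdens := ae_all_iff.2 fun K : ℕ =>
      IsUnifLocDoublingMeasure.ae_tendsto_measure_inter_div
        (volume : Measure (Fin m → Fin n → ℝ)) {A | u A ∈ avoidingSet a (Γ m n) O} K
    rw [ae_restrict_iff' hclosed.measurableSet] at hdens
    filter_upwards [hdens, ae_exists_tendsto_diagonal_mul_horospherical hm hn ha hu]
      with A hA hrec hmem
    obtain ⟨φ, hφ, γ, x, hx⟩ := hrec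
    obtain ⟨A', hA'⟩ := exists_horospherical_mul_notMem_avoidingSet ha hu hg₀' hO hne x
    exact hA' (horospherical_mul_mem_avoidingSet hm ha hu hO
      (fun K w δ hδ hw => hA hmem K w δ hδ hw) hφ hx A')
  have hbasis := TopologicalSpace.isBasis_countableBasis
    (SpecialLinearGroup (Fin m ⊕ Fin n) ℝ)
  have hae : ∀ᵐ A : Fin m → Fin n → ℝ,
      ∀ O ∈ TopologicalSpace.countableBasis (SpecialLinearGroup (Fin m ⊕ Fin n) ℝ),
        u A ∉ avoidingSet a (Γ m n) O := by
    rw [ae_ball_iff (TopologicalSpace.countable_countableBasis _)]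
    exact fun O hO => hnull O (hbasis.isOpen hO)
      (TopologicalSpace.nonempty_of_mem_countableBasis hO)
  filter_upwards [hae] with A hA
  rw [dense_range_quotient_iff (Γ m n) fun s : Set.Ioi (0 : ℝ) => a s * u A]
  rintro O hO ⟨o, ho⟩
  obtain ⟨V, hV, -, hVO⟩ := hbasis.exists_subset_of_mem_open ho hO
  have := hA V hV
  simp only [avoidingSet, Set.mem_ofPred_eq, not_forall, not_not] at this
  obtain ⟨s, hs, γ, hγ, h⟩ := this
  exact ⟨⟨s, hs⟩, γ, hγ, hVO h⟩
end
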